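/- For every fixed ε > 0, every sufficiently large integer m, and every invertible element λ of ℤ/mℤ, there exist positive integers x₁, …, x₆, each at most m^(1/3+ε), such that λ ≡ x₁x₂x₃x₄x₅x₆ (mod m). -/

import Mathlib

section

open Finset
open ArithmeticFunction (vonMangoldt)

/-- The divisor bound: `τ(n) ≪ n ^ ρ` for every `ρ > 0`. -/
theorem exists_card_divisors_le_rpow {ρ : ℝ} (hρ : 0 < ρ) :
    ∃ C : ℝ, 1 ≤ C ∧ ∀ n : ℕ, n ≠ 0 → (#n.divisors : ℝ) ≤ C * (n : ℝ) ^ ρ := by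
  have hl2 : 0 < Real.log 2 := Real.log_pos (by norm_num)
  set A : ℝ := 1 + 1 / (ρ * Real.log 2) with hA
  have hA1 : 1 ≤ A := by rw [hA]; have : 0 < 1 / (ρ * Real.log 2) := by positivity
                         linarith
  set P : ℕ := ⌈(2 : ℝ) ^ (1 / ρ)⌉₊ with hP
  have key : ∀ p f : ℕ, 2 ≤ p → ((f : ℝ) + 1) ≤ (if p < P then A else 1) * ((p : ℝ) ^ ρ) ^ f := by
    intro p f hp
    have hp2 : (2 : ℝ) ≤ p := by exact_mod_cast hp
    split_ifs with h
    · have h1 : (2 : ℝ) ^ ρ ≤ (p : ℝ) ^ ρ := Real.rpow_le_rpow (by norm_num) hp2 hρ.le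
      have h2 : 1 + ρ * Real.log 2 ≤ (2 : ℝ) ^ ρ := by
        rw [Real.rpow_def_of_pos (by norm_num)]
        have := Real.add_one_le_exp (Real.log 2 * ρ)
        linarith
      have h3 : 1 + (f : ℝ) * (ρ * Real.log 2) ≤ (1 + ρ * Real.log 2) ^ f :=
        one_add_mul_le_pow (by have : 0 < ρ * Real.log 2 := by positivity
                               linarith) f
      have h4 : (1 + ρ * Real.log 2) ^ f ≤ ((p : ℝ) ^ ρ) ^ f :=
        pow_le_pow_left₀ (by positivity) (h2.trans h1) f
      calc (f : ℝ) + 1 ≤ A * (1 + (f : ℝ) * (ρ * Real.log 2)) := by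
            rw [hA]
            have : 0 < ρ * Real.log 2 := by positivity
            have h5 : 1 / (ρ * Real.log 2) * ((f : ℝ) * (ρ * Real.log 2)) = f := by field_simp
            have h6 : 0 < 1 / (ρ * Real.log 2) := by positivity
            have h7 : 0 ≤ (f : ℝ) * (ρ * Real.log 2) := by positivity
            nlinarith
        _ ≤ A * ((p : ℝ) ^ ρ) ^ f := by gcongr; exact h3.trans h4
    · have h1 : (2 : ℝ) ^ (1 / ρ) ≤ p := (Nat.le_ceil _).trans (by exact_mod_cast not_lt.mp h)
      have h2 : (2 : ℝ) ≤ (p : ℝ) ^ ρ := by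
        calc (2 : ℝ) = ((2 : ℝ) ^ (1 / ρ)) ^ ρ := by
              rw [← Real.rpow_mul (by norm_num)]; field_simp; simp
          _ ≤ _ := Real.rpow_le_rpow (by positivity) h1 hρ.le
      rw [one_mul]
      calc (f : ℝ) + 1 ≤ 2 ^ f := by exact_mod_cast Nat.lt_two_pow_self
        _ ≤ _ := pow_le_pow_left₀ (by norm_num) h2 f
  refine ⟨A ^ P, one_le_pow₀ hA1, fun n hn => ?_⟩
  rw [Nat.card_divisors hn]
  push_cast
  calc ∏ p ∈ n.primeFactors, ((n.factorization p : ℝ) + 1)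
      ≤ ∏ p ∈ n.primeFactors, ((if p < P then A else 1) * ((p : ℝ) ^ ρ) ^ n.factorization p) :=
        prod_le_prod (fun _ _ => by positivity)
          (fun p hp => key p _ (Nat.prime_of_mem_primeFactors hp).two_le)
    _ = (∏ p ∈ n.primeFactors, (if p < P then A else 1)) *
          ∏ p ∈ n.primeFactors, ((p : ℝ) ^ ρ) ^ n.factorization p := prod_mul_distrib
    _ ≤ A ^ P * (n : ℝ) ^ ρ := by
        refine mul_le_mul ?_ ?_ (prod_nonneg fun p _ => by positivity) (by positivity)
        · rw [prod_ite, prod_const, prod_const_one, mul_one]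
          refine pow_le_pow_right₀ hA1 ?_
          calc #(n.primeFactors.filter (· < P)) ≤ #(range P) :=
                card_le_card fun p hp => by simp at hp ⊢; exact hp.2
            _ = P := card_range P
        · apply le_of_eq
          conv_rhs => rw [← Nat.prod_factorization_pow_eq_self hn]
          rw [Finsupp.prod, Nat.cast_prod, Nat.support_factorization,
            ← Real.finsetProd_rpow _ _ (fun _ _ => by positivity)]
          refine prod_congr rfl fun p _ => ?_
          rw [Nat.cast_pow, ← Real.rpow_natCast, ← Real.rpow_natCast, ← Real.rpow_mul (by positivity),
            ← Real.rpow_mul (by positivity), mul_comm]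

/-- The number of positive integers up to `Z` that are coprime to `m`. -/
def coprimeCount (m Z : ℕ) : ℕ := #{n ∈ Icc 1 Z | n.Coprime m}

theorem coprimeCount_eq_sum_moebius {m : ℕ} (hm : m ≠ 0) (Z : ℕ) :
    (coprimeCount m Z : ℤ) = ∑ d ∈ m.divisors, ArithmeticFunction.moebius d * ((Z / d : ℕ) : ℤ) := by
  have h : ∀ n ∈ Icc 1 Z, (if n.Coprime m then (1 : ℤ) else 0) =
      ∑ d ∈ m.divisors, if d ∣ n then ArithmeticFunction.moebius d else 0 := by
    intro n hn
    have h1 : (∑ d ∈ (n.gcd m).divisors, ArithmeticFunction.moebius d) =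
        if n.gcd m = 1 then 1 else 0 := by
      rw [← ArithmeticFunction.coe_mul_zeta_apply, ArithmeticFunction.moebius_mul_coe_zeta,
        ArithmeticFunction.one_apply]
    simp only [Nat.coprime_iff_gcd_eq_one]
    rw [← h1, ← sum_filter]
    refine sum_congr ?_ fun _ _ => rfl
    ext d
    simp only [Nat.mem_divisors, mem_filter, Nat.dvd_gcd_iff]
    have := Nat.gcd_pos_of_pos_right n (Nat.pos_of_ne_zero hm)
    constructor
    · rintro ⟨⟨a, b⟩, _⟩; exact ⟨⟨b, hm⟩, a⟩
    · rintro ⟨⟨a, b⟩, c⟩; exact ⟨⟨c, a⟩, by omega⟩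
  rw [coprimeCount, card_filter]
  push_cast
  rw [sum_congr rfl h, sum_comm]
  refine sum_congr rfl fun d hd => ?_
  rw [← sum_filter, sum_const, nsmul_eq_mul, mul_comm]
  congr 2
  exact Nat.Ioc_filter_dvd_card_eq_div Z d

theorem abs_coprimeCount_sub_le {m : ℕ} (hm : m ≠ 0) (Z : ℕ) :
    |(coprimeCount m Z : ℝ) - Z * (m.totient / m)| ≤ #m.divisors := by
  have hm' : (m : ℝ) ≠ 0 := by exact_mod_cast hm
  have h1 : (coprimeCount m Z : ℝ) =
      ∑ d ∈ m.divisors, (ArithmeticFunction.moebius d : ℝ) * ((Z / d : ℕ) : ℝ) := by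
    have := congrArg (Int.cast : ℤ → ℝ) (coprimeCount_eq_sum_moebius hm Z)
    push_cast at this
    exact this
  have h2 : (m.totient : ℝ) =
      ∑ d ∈ m.divisors, (ArithmeticFunction.moebius d : ℝ) * ((m / d : ℕ) : ℝ) := by
    have h3 : m.totient = coprimeCount m m := by
      rw [← Nat.filter_coprime_Ico_eq_totient m 1, coprimeCount]
      congr 1
      ext n
      simp [Nat.coprime_comm]
      omega
    rw [h3]
    have := congrArg (Int.cast : ℤ → ℝ) (coprimeCount_eq_sum_moebius hm m)
    push_cast at this
    exact this
  have h4 : (Z : ℝ) * (m.totient / m) =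
      ∑ d ∈ m.divisors, (ArithmeticFunction.moebius d : ℝ) * ((Z : ℝ) / d) := by
    rw [h2, sum_div, mul_sum]
    refine sum_congr rfl fun d hd => ?_
    have hd' : d ∣ m := Nat.dvd_of_mem_divisors hd
    have hd0 : (d : ℝ) ≠ 0 := by
      exact_mod_cast (Nat.pos_of_mem_divisors hd).ne'
    rw [Nat.cast_div hd' hd0]
    field_simp
  rw [h1, h4, ← sum_sub_distrib, card_eq_sum_ones, Nat.cast_sum]
  refine (abs_sum_le_sum_abs _ _).trans (sum_le_sum fun d hd => ?_)
  rw [← mul_sub, abs_mul]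
  have h5 : |(ArithmeticFunction.moebius d : ℝ)| ≤ 1 := by
    exact_mod_cast ArithmeticFunction.abs_moebius_le_one
  have h6 : |((Z / d : ℕ) : ℝ) - (Z : ℝ) / d| ≤ 1 := by
    rw [abs_le]
    have a1 : ((Z / d : ℕ) : ℝ) ≤ (Z : ℝ) / d := Nat.cast_div_le
    have a2 : (Z : ℝ) / d < ((Z / d : ℕ) : ℝ) + 1 := by
      rw [← Nat.floor_div_eq_div (K := ℝ)]; exact Nat.lt_floor_add_one _
    constructor <;> linarith
  calc _ ≤ (1 : ℝ) * 1 := mul_le_mul h5 h6 (abs_nonneg _) (by norm_num)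
    _ = _ := by norm_num

theorem le_totient_mul_card_divisors (m : ℕ) : m ≤ m.totient * #m.divisors := by
  conv_lhs => rw [← Nat.sum_totient m]
  rw [mul_comm, ← smul_eq_mul]
  refine sum_le_card_nsmul _ _ _ fun d hd => ?_
  have hd' := Nat.mem_divisors.mp hd
  exact Nat.le_of_dvd (Nat.totient_pos.mpr (Nat.pos_of_ne_zero hd'.2)) (Nat.totient_dvd_of_dvd hd'.1)

theorem le_coprimeCount {m : ℕ} (hm : m ≠ 0) (Z : ℕ) :
    (Z : ℝ) / #m.divisors - #m.divisors ≤ coprimeCount m Z := by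
  have h1 := abs_le.mp (abs_coprimeCount_sub_le hm Z)
  have hm' : (0 : ℝ) < m := by exact_mod_cast Nat.pos_of_ne_zero hm
  have ht : (0 : ℝ) < #m.divisors := by
    exact_mod_cast card_pos.mpr (Nat.nonempty_divisors.mpr hm)
  have h2 : 1 / (#m.divisors : ℝ) ≤ m.totient / m := by
    rw [div_le_div_iff₀ ht hm', one_mul]
    exact_mod_cast le_totient_mul_card_divisors m
  have h3 : (Z : ℝ) / #m.divisors ≤ Z * (m.totient / m) := by
    rw [div_eq_mul_one_div]; gcongr
  linarith

theorem coprimeCount_div_ge {m : ℕ} (hm : m ≠ 0) (X : ℕ) {d : ℕ} (hd : 1 ≤ d) :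
    (coprimeCount m X : ℝ) / d - 3 * #m.divisors ≤ coprimeCount m (X / d) := by
  have h1 := abs_le.mp (abs_coprimeCount_sub_le hm X)
  have h2 := abs_le.mp (abs_coprimeCount_sub_le hm (X / d))
  have hd' : (1 : ℝ) ≤ d := by exact_mod_cast hd
  have hm' : (0 : ℝ) < m := by exact_mod_cast Nat.pos_of_ne_zero hm
  have ht : (1 : ℝ) ≤ #m.divisors := by
    exact_mod_cast card_pos.mpr (Nat.nonempty_divisors.mpr hm)
  have a2 : (X : ℝ) / d < ((X / d : ℕ) : ℝ) + 1 := by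
    rw [← Nat.floor_div_eq_div (K := ℝ)]; exact Nat.lt_floor_add_one _
  have h0 : 0 ≤ (m.totient : ℝ) / m := by positivity
  have h3 : (m.totient : ℝ) / m ≤ 1 := by
    rw [div_le_one hm']; exact_mod_cast Nat.totient_le m
  have h4 : (coprimeCount m X : ℝ) / d ≤ (X : ℝ) / d * (m.totient / m) + #m.divisors := by
    rw [div_le_iff₀ (by linarith)]
    have : ((X : ℝ) / d * (m.totient / m) + #m.divisors) * d =
      X * (m.totient / m) + #m.divisors * d := by field_simp
    rw [this]; nlinarith
  nlinarith

theorem norm_sum_dirichletCharacter_mul_conj_le {m : ℕ} [NeZero m] (x y : ZMod m) :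
    ‖∑ χ : DirichletCharacter ℂ m, χ x * star (χ y)‖ ≤ if x = y then (m.totient : ℝ) else 0 := by
  by_cases hy : IsUnit y
  · have h : ∀ χ : DirichletCharacter ℂ m, χ x * star (χ y) = χ y⁻¹ * χ x := by
      intro χ
      obtain ⟨u, rfl⟩ := hy
      rw [mul_comm, MulChar.star_apply', MulChar.inv_apply, ZMod.inv_coe_unit,
        Ring.inverse_unit]
    rw [sum_congr rfl fun χ _ => h χ, DirichletCharacter.sum_char_inv_mul_char_eq ℂ hy]
    by_cases hxy : x = y
    · simp [hxy]
    · simp [hxy, Ne.symm hxy]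
  · have h : ∀ χ : DirichletCharacter ℂ m, χ x * star (χ y) = 0 := by
      intro χ
      rw [MulChar.map_nonunit χ hy, star_zero, mul_zero]
    rw [sum_congr rfl fun χ _ => h χ]
    simp only [sum_const_zero, norm_zero]
    positivity

theorem card_filter_Icc_natCast_eq_le (m : ℕ) [NeZero m] (Y : ℕ) (c : ZMod m) :
    #{n ∈ Icc 1 Y | ((n : ℕ) : ZMod m) = c} ≤ Y / m + 1 := by
  have hm : 0 < m := Nat.pos_of_ne_zero (NeZero.ne m)
  have h := Nat.Ioc_filter_modEq_card 0 Y hm c.val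
  have h1 : {n ∈ Icc 1 Y | ((n : ℕ) : ZMod m) = c} = {n ∈ Ioc 0 Y | n ≡ c.val [MOD m]} := by
    ext n
    simp only [mem_filter, mem_Icc, mem_Ioc, ← ZMod.natCast_eq_natCast_iff, ZMod.natCast_val,
      ZMod.cast_id', id_eq]
    rfl
  rw [h1]
  have hm' : (0 : ℚ) < m := by exact_mod_cast hm
  have h2 : ⌊((Y : ℚ) - c.val) / m⌋ - ⌊(((0 : ℕ) : ℚ) - c.val) / m⌋ ≤ ((Y / m + 1 : ℕ) : ℤ) := by
    have e : ((Y : ℚ) - c.val) / m = (Y : ℚ) / m + ((((0 : ℕ) : ℚ) - c.val) / m) := by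
      push_cast; ring
    have e2 : ⌊((Y : ℚ) - c.val) / m⌋ ≤
        ⌊(Y : ℚ) / m⌋ + ⌊(((0 : ℕ) : ℚ) - c.val) / m⌋ + 1 := by
      rw [e]
      have := Int.le_floor_add_floor ((Y : ℚ) / m) ((((0 : ℕ) : ℚ) - c.val) / m)
      omega
    have e3 : ⌊(Y : ℚ) / m⌋ = ((Y / m : ℕ) : ℤ) := by
      rw [Rat.floor_natCast_div_natCast]; simp
    push_cast at *
    omega
  have h3 : ((#{n ∈ Ioc 0 Y | n ≡ c.val [MOD m]} : ℕ) : ℤ) ≤ ((Y / m + 1 : ℕ) : ℤ) := by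
    rw [h]; exact max_le h2 (by positivity)
  exact_mod_cast h3

/-- A large sieve type bound for the second moment of a character sum over all characters. -/
theorem sum_norm_sq_charSum_le {m : ℕ} [NeZero m] {ι : Type*} (s : Finset ι) (a : ι → ℂ)
    (ha : ∀ i ∈ s, ‖a i‖ ≤ 1) (v : ι → ℕ) {Y D : ℕ} (hv : ∀ i ∈ s, v i ∈ Icc 1 Y)
    (hD : ∀ n ∈ Icc 1 Y, #{i ∈ s | v i = n} ≤ D) (hY : m ≤ Y) :
    ∑ χ : DirichletCharacter ℂ m, ‖∑ i ∈ s, a i * χ (v i)‖ ^ 2 ≤ 2 * (D : ℝ) ^ 2 * (Y : ℝ) ^ 2 := by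
  classical
  have hm : 0 < m := Nat.pos_of_ne_zero (NeZero.ne m)
  have hs : #s ≤ Y * D := by
    calc #s ≤ D * #(Icc 1 Y) := card_le_mul_card_image_of_maps_to hv D hD
      _ = Y * D := by rw [Nat.card_Icc]; simp [mul_comm]
  have hfib : ∀ i ∈ s, #{j ∈ s | (v i : ZMod m) = (v j : ZMod m)} ≤ (Y / m + 1) * D := by
    intro i _
    calc #{j ∈ s | (v i : ZMod m) = (v j : ZMod m)}
        ≤ D * #{n ∈ Icc 1 Y | ((n : ℕ) : ZMod m) = (v i : ZMod m)} := by
          refine card_le_mul_card_image_of_maps_to (f := v) ?_ D ?_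
          · intro j hj
            rw [mem_filter] at hj ⊢
            exact ⟨hv j hj.1, hj.2.symm⟩
          · intro n hn
            refine (card_le_card ?_).trans (hD n (mem_filter.mp hn).1)
            intro j hj
            simp only [mem_filter] at hj ⊢
            exact ⟨hj.1.1, hj.2⟩
      _ ≤ D * (Y / m + 1) := Nat.mul_le_mul_left _ (card_filter_Icc_natCast_eq_le m Y _)
      _ = _ := mul_comm _ _
  have hexp : ((∑ χ : DirichletCharacter ℂ m, ‖∑ i ∈ s, a i * χ (v i)‖ ^ 2 : ℝ) : ℂ) =
      ∑ i ∈ s, ∑ j ∈ s, a i * star (a j) *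
        ∑ χ : DirichletCharacter ℂ m, χ (v i) * star (χ (v j)) := by
    push_cast
    simp_rw [← Complex.mul_conj', mul_sum]
    rw [sum_congr rfl fun i _ => sum_comm, sum_comm]
    refine sum_congr rfl fun χ _ => ?_
    rw [map_sum, sum_mul_sum]
    refine sum_congr rfl fun i _ => sum_congr rfl fun j _ => ?_
    rw [map_mul, starRingEnd_apply, starRingEnd_apply]
    ring
  have h1 : ∑ χ : DirichletCharacter ℂ m, ‖∑ i ∈ s, a i * χ (v i)‖ ^ 2 ≤
      ∑ i ∈ s, ∑ j ∈ s, if (v i : ZMod m) = (v j : ZMod m) then (m.totient : ℝ) else 0 := by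
    have h2 : ‖((∑ χ : DirichletCharacter ℂ m, ‖∑ i ∈ s, a i * χ (v i)‖ ^ 2 : ℝ) : ℂ)‖ ≤
        ∑ i ∈ s, ∑ j ∈ s, if (v i : ZMod m) = (v j : ZMod m) then (m.totient : ℝ) else 0 := by
      rw [hexp]
      refine (norm_sum_le _ _).trans (sum_le_sum fun i hi => ?_)
      refine (norm_sum_le _ _).trans (sum_le_sum fun j hj => ?_)
      rw [norm_mul, norm_mul, norm_star]
      have h3 := norm_sum_dirichletCharacter_mul_conj_le (v i : ZMod m) (v j : ZMod m)
      have h4 : ‖a i‖ * ‖a j‖ ≤ 1 := mul_le_one₀ (ha i hi) (norm_nonneg _) (ha j hj)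
      calc _ ≤ 1 * _ := mul_le_mul h4 h3 (norm_nonneg _) (by norm_num)
        _ = _ := one_mul _
    rw [Complex.norm_real] at h2
    exact (le_abs_self _).trans h2
  refine h1.trans ?_
  have h5 : ∀ i ∈ s, (∑ j ∈ s, if (v i : ZMod m) = (v j : ZMod m) then (m.totient : ℝ) else 0) ≤
      2 * D * Y := by
    intro i hi
    rw [← sum_filter, sum_const, nsmul_eq_mul]
    have h6 : (#{j ∈ s | (v i : ZMod m) = (v j : ZMod m)} : ℝ) ≤ ((Y / m + 1) * D : ℕ) := by
      exact_mod_cast hfib i hi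
    have h7 : m.totient * ((Y / m + 1) * D) ≤ 2 * D * Y := by
      have := Nat.totient_le m
      have h8 : m * (Y / m) ≤ Y := Nat.mul_div_le Y m
      calc m.totient * ((Y / m + 1) * D) ≤ m * ((Y / m + 1) * D) := Nat.mul_le_mul_right _ this
        _ = (m * (Y / m) + m) * D := by ring
        _ ≤ (Y + Y) * D := Nat.mul_le_mul_right _ (by omega)
        _ = _ := by ring
    calc _ ≤ (((Y / m + 1) * D : ℕ) : ℝ) * m.totient := by gcongr
      _ ≤ _ := by rw [mul_comm]; exact_mod_cast h7
  refine (sum_le_card_nsmul _ _ _ h5).trans ?_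
  rw [nsmul_eq_mul]
  have : (#s : ℝ) ≤ Y * D := by exact_mod_cast hs
  calc (#s : ℝ) * (2 * D * Y) ≤ (Y * D) * (2 * D * Y) := by gcongr
    _ = _ := by ring

theorem card_filter_natCast_mul_eq_zero {m : ℕ} [NeZero m] {d : ℕ} (hd : d ∣ m) :
    #{b : ZMod m | (d : ZMod m) * b = 0} = d := by
  have hm : m ≠ 0 := NeZero.ne m
  have h := IsAddCyclic.card_nsmulAddMonoidHom_ker (G := ZMod m) d
  rw [Nat.card_zmod, Nat.gcd_eq_right hd] at h
  rw [← SetLike.coe_sort_coe, Nat.card_coe_set_eq] at h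
  conv_rhs => rw [← h]
  rw [← Set.ncard_coe_finset]
  congr 1
  ext b
  simp [AddMonoidHom.mem_ker]

theorem card_filter_mul_eq_zero_le {m : ℕ} [NeZero m] (a : ZMod m) :
    #{x : ZMod m | x * a = 0} ≤ a.val.gcd m := by
  refine le_of_le_of_eq (card_le_card ?_)
    (card_filter_natCast_mul_eq_zero (m := m) (Nat.gcd_dvd_right a.val m))
  intro x hx
  simp only [mem_filter, mem_univ, true_and] at hx ⊢
  have h := congrArg (Int.cast : ℤ → ZMod m) (Nat.gcd_eq_gcd_ab a.val m)
  push_cast at h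
  rw [h]
  simp only [ZMod.natCast_val, ZMod.cast_id', id_eq, CharP.cast_eq_zero, zero_mul, add_zero]
  rw [mul_comm, ← mul_assoc, hx, zero_mul]

/-- Multiplying by a proper divisor: `a` has exactly `gcd(a, m)` preimages under
`b ↦ gcd(a, m) * b`. -/
theorem card_filter_gcd_mul_eq {m : ℕ} [NeZero m] (a : ZMod m) :
    #{b : ZMod m | ((a.val.gcd m : ℕ) : ZMod m) * b = a} = a.val.gcd m := by
  set d := a.val.gcd m with hd
  have hb : ((d : ℕ) : ZMod m) * ((a.val / d : ℕ) : ZMod m) = a := by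
    rw [← Nat.cast_mul, Nat.mul_div_cancel' (Nat.gcd_dvd_left _ _)]
    simp
  refine Eq.trans ?_ (card_filter_natCast_mul_eq_zero (m := m) (Nat.gcd_dvd_right a.val m))
  refine card_bij (fun b _ => b - ((a.val / d : ℕ) : ZMod m)) ?_ ?_ ?_
  · intro b h
    simp only [mem_filter, mem_univ, true_and] at h ⊢
    rw [mul_sub, h, hb, sub_self]
  · intro b _ b' _ h
    exact sub_left_injective h
  · intro b h
    refine ⟨b + ((a.val / d : ℕ) : ZMod m), ?_, by simp⟩
    simp only [mem_filter, mem_univ, true_and] at h ⊢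
    rw [mul_add, h, hb, zero_add]

/-- Parseval's identity on `ZMod m`. -/
theorem sum_norm_sq_stdAddChar_sum {m : ℕ} [NeZero m] {ι : Type*} (s : Finset ι) (c : ι → ℂ)
    (v : ι → ZMod m) :
    ((∑ a : ZMod m, ‖∑ i ∈ s, c i * ZMod.stdAddChar (a * v i)‖ ^ 2 : ℝ) : ℂ) =
      m * ∑ i ∈ s, ∑ j ∈ s, if v i = v j then c i * star (c j) else 0 := by
  push_cast
  simp_rw [← Complex.mul_conj', map_sum, sum_mul_sum]
  rw [sum_comm, mul_sum]
  refine sum_congr rfl fun i _ => ?_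
  rw [sum_comm, mul_sum]
  refine sum_congr rfl fun j _ => ?_
  have h : ∀ a : ZMod m, c i * ZMod.stdAddChar (a * v i) *
      (starRingEnd ℂ) (c j * ZMod.stdAddChar (a * v j)) =
      c i * star (c j) * ZMod.stdAddChar (a * (v i - v j)) := by
    intro a
    rw [map_mul (starRingEnd ℂ), ← AddChar.map_neg_eq_conj, mul_sub, sub_eq_add_neg, AddChar.map_add_eq_mul,
      starRingEnd_apply, ← mul_neg]
    ring
  rw [sum_congr rfl fun a _ => h a, ← mul_sum,
    AddChar.sum_mulShift _ (ZMod.isPrimitive_stdAddChar m)]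
  simp only [sub_eq_zero, ZMod.card]
  split_ifs <;> simp [mul_comm]

theorem norm_gaussSum_mulShift_sq_le {m : ℕ} [NeZero m] (χ : DirichletCharacter ℂ m)
    (a : ZMod m) :
    ‖gaussSum χ (ZMod.stdAddChar.mulShift a)‖ ^ 2 ≤ m * #{x : ZMod m | x * a = 0} := by
  classical
  have hm : 0 < m := Nat.pos_of_ne_zero (NeZero.ne m)
  set G : ZMod m → ℂ := fun a => gaussSum χ (ZMod.stdAddChar.mulShift a) with hG
  have hu : ∀ u : (ZMod m)ˣ, ‖G (u * a)‖ = ‖G a‖ := by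
    intro u
    have h := gaussSum_mulShift χ (ZMod.stdAddChar.mulShift a) u
    rw [AddChar.mulShift_mulShift, mul_comm] at h
    have h2 := congrArg norm h
    rw [norm_mul, mul_comm a] at h2
    have h3 : ‖χ (u : ZMod m)‖ = 1 := DirichletCharacter.unit_norm_eq_one χ u
    rw [h3, mul_one] at h2
    exact h2
  have hP : ∑ b : ZMod m, ‖G b‖ ^ 2 = m * m.totient := by
    have h := sum_norm_sq_stdAddChar_sum (m := m) univ (fun x => χ x) id
    have h1 : (∑ i : ZMod m, ∑ j : ZMod m, if id i = id j then χ i * star (χ j) else 0) =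
        (m.totient : ℂ) := by
      simp only [id, sum_ite_eq, mem_univ, if_true]
      have h2 : ∀ i : ZMod m, χ i * star (χ i) = if IsUnit i then 1 else 0 := by
        intro i
        split_ifs with hi
        · obtain ⟨u, rfl⟩ := hi
          rw [← starRingEnd_apply, Complex.mul_conj', DirichletCharacter.unit_norm_eq_one]
          simp
        · rw [MulChar.map_nonunit χ hi, zero_mul]
      rw [sum_congr rfl fun i _ => h2 i, sum_boole, ← ZMod.card_units_eq_totient,
        ← Fintype.card_subtype]
      congr 1
      exact Fintype.card_congr (Equiv.ofBijective
        (fun u : (ZMod m)ˣ => (⟨u, u.isUnit⟩ : {x : ZMod m // IsUnit x}))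
        ⟨fun u u' h => Units.ext (congrArg Subtype.val h), fun x => by
          obtain ⟨u, hu⟩ := x.2
          exact ⟨u, Subtype.ext hu⟩⟩).symm
    rw [h1] at h
    have h4 : ∀ b, G b = ∑ x : ZMod m, χ x * ZMod.stdAddChar (b * id x) := fun b => by
      simp [hG, gaussSum, AddChar.mulShift_apply]
    simp_rw [h4]
    exact_mod_cast h
  have hφ : (0 : ℝ) < m.totient := by exact_mod_cast Nat.totient_pos.mpr hm
  have hmul : (m.totient : ℝ) * ‖G a‖ ^ 2 ≤ (m * #{x : ZMod m | x * a = 0}) * m.totient := by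
    calc (m.totient : ℝ) * ‖G a‖ ^ 2 = ∑ u : (ZMod m)ˣ, ‖G (u * a)‖ ^ 2 := by
          simp_rw [hu]
          rw [sum_const, card_univ, ZMod.card_units_eq_totient, nsmul_eq_mul]
      _ = ∑ b : ZMod m, ∑ u ∈ univ.filter (fun u : (ZMod m)ˣ => (u : ZMod m) * a = b), ‖G b‖ ^ 2 := by
          rw [← sum_fiberwise (s := univ) (g := fun u : (ZMod m)ˣ => (u : ZMod m) * a)]
          refine sum_congr rfl fun b _ => sum_congr rfl fun u hu => ?_
          rw [(mem_filter.mp hu).2]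
      _ ≤ ∑ b : ZMod m, (#{x : ZMod m | x * a = 0} : ℝ) * ‖G b‖ ^ 2 := by
          refine sum_le_sum fun b _ => ?_
          rw [sum_const, nsmul_eq_mul]
          gcongr
          by_cases he : (univ.filter (fun u : (ZMod m)ˣ => (u : ZMod m) * a = b)).Nonempty
          · obtain ⟨u₀, h₀⟩ := he
            refine card_le_card_of_injOn (fun u => (u : ZMod m) - u₀) ?_ ?_
            · intro u hu
              simp only [coe_filter, mem_filter, mem_univ, true_and, Set.mem_ofPred_eq] at hu h₀ ⊢
              rw [sub_mul, hu, h₀, sub_self]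
            · intro u _ u' _ h
              exact Units.ext (sub_left_injective h)
          · rw [not_nonempty_iff_eq_empty.mp he, card_empty]; exact Nat.zero_le _
      _ = _ := by rw [← mul_sum, hP]; ring
  rw [mul_comm] at hmul
  exact le_of_mul_le_mul_right hmul hφ

theorem sum_norm_sq_stdAddChar_natCast_mul_le {m : ℕ} [NeZero m] {d : ℕ} (hd : d ∣ m) (H : ℕ) :
    ∑ b : ZMod m, (if (d : ZMod m) * b = 0 then 0 else
      ‖∑ h ∈ Icc 1 H, ZMod.stdAddChar ((d : ZMod m) * b * (-(h : ZMod m)))‖ ^ 2) ≤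
      (m * H : ℝ) := by
  have hm : 0 < m := Nat.pos_of_ne_zero (NeZero.ne m)
  obtain ⟨q, hq⟩ := hd
  have hq0 : 0 < q := Nat.pos_of_mul_pos_left (hq ▸ hm)
  have hd0 : 0 < d := Nat.pos_of_mul_pos_right (hq ▸ hm)
  have : NeZero q := ⟨hq0.ne'⟩
  have hfull : ∑ b : ZMod m,
      ‖∑ h ∈ Icc 1 H, ZMod.stdAddChar ((d : ZMod m) * b * (-(h : ZMod m)))‖ ^ 2 ≤
      (d * H ^ 2 + m * H : ℝ) := by
    have h1 := sum_norm_sq_stdAddChar_sum (m := m) (Icc 1 H) (fun _ => 1)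
      (fun h => -((d : ZMod m) * (h : ZMod m)))
    have h2 : ∀ b : ZMod m, ∀ h : ℕ, (d : ZMod m) * b * (-(h : ZMod m)) =
        b * (-((d : ZMod m) * (h : ZMod m))) := fun b h => by ring
    simp_rw [h2]
    simp only [one_mul, star_one, mul_one] at h1
    have h3 : ∑ b : ZMod m,
        ‖∑ h ∈ Icc 1 H, ZMod.stdAddChar (b * (-((d : ZMod m) * (h : ZMod m))))‖ ^ 2 =
        (m : ℝ) * ∑ h ∈ Icc 1 H, ∑ h' ∈ Icc 1 H,
          if -((d : ZMod m) * (h : ZMod m)) = -((d : ZMod m) * (h' : ZMod m)) then 1 else 0 := by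
      apply Complex.ofReal_injective
      rw [Complex.ofReal_sum]
      push_cast
      push_cast at h1
      simp only [apply_ite Complex.ofReal, Complex.ofReal_one, Complex.ofReal_zero]
      exact h1
    rw [h3]
    have h4 : ∀ h ∈ Icc 1 H, (∑ h' ∈ Icc 1 H,
          if -((d : ZMod m) * (h : ZMod m)) = -((d : ZMod m) * (h' : ZMod m)) then (1 : ℝ) else 0)
          ≤ ((H / q + 1 : ℕ) : ℝ) := by
      intro h _
      rw [sum_boole]
      norm_cast
      refine (card_le_card ?_).trans (card_filter_Icc_natCast_eq_le q H (h : ZMod q))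
      intro h' hh
      simp only [mem_filter, neg_inj] at hh ⊢
      refine ⟨hh.1, ?_⟩
      have h5 : ((d * h : ℕ) : ZMod m) = ((d * h' : ℕ) : ZMod m) := by exact_mod_cast hh.2
      rw [ZMod.natCast_eq_natCast_iff, hq] at h5
      rw [ZMod.natCast_eq_natCast_iff]
      exact (Nat.ModEq.mul_left_cancel' hd0.ne' h5).symm
    have h6 := sum_le_card_nsmul _ _ _ h4
    rw [Nat.card_Icc, Nat.add_sub_cancel, nsmul_eq_mul] at h6
    have h7 : m * (H * (H / q + 1)) ≤ d * H ^ 2 + m * H := by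
      have h8 : q * (H / q) ≤ H := Nat.mul_div_le H q
      calc m * (H * (H / q + 1)) = d * H * (q * (H / q)) + m * H := by rw [hq]; ring
        _ ≤ d * H * H + m * H := by gcongr
        _ = _ := by ring
    calc _ ≤ (m : ℝ) * ((H : ℝ) * ((H / q + 1 : ℕ) : ℝ)) := by gcongr
      _ ≤ _ := by exact_mod_cast h7
  have hzero : ∑ b : ZMod m, (if (d : ZMod m) * b = 0 then ((H : ℝ) ^ 2) else 0) = d * H ^ 2 := by
    rw [← sum_filter, sum_const, card_filter_natCast_mul_eq_zero ⟨q, hq⟩, nsmul_eq_mul]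
  have hsplit : ∀ b : ZMod m, (if (d : ZMod m) * b = 0 then (0 : ℝ) else
      ‖∑ h ∈ Icc 1 H, ZMod.stdAddChar ((d : ZMod m) * b * (-(h : ZMod m)))‖ ^ 2) =
      ‖∑ h ∈ Icc 1 H, ZMod.stdAddChar ((d : ZMod m) * b * (-(h : ZMod m)))‖ ^ 2 -
        (if (d : ZMod m) * b = 0 then ((H : ℝ) ^ 2) else 0) := by
    intro b
    split_ifs with hb
    · simp [hb]
    · rw [sub_zero]
  rw [sum_congr rfl fun b _ => hsplit b, sum_sub_distrib, hzero]
  linarith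

/-- The second moment of short character sums over a complete residue system. -/
theorem sum_norm_sq_short_charSum_le {m : ℕ} [NeZero m] {χ : DirichletCharacter ℂ m}
    (hχ : χ ≠ 1) (H : ℕ) :
    ∑ x : ZMod m, ‖∑ h ∈ Icc 1 H, χ (x + (h : ZMod m))‖ ^ 2 ≤ #m.divisors * m * (H : ℝ) := by
  have hm : 0 < m := Nat.pos_of_ne_zero (NeZero.ne m)
  have hm' : (0 : ℝ) < m := by exact_mod_cast hm
  set G : ZMod m → ℂ := fun a => gaussSum χ (ZMod.stdAddChar.mulShift a) with hG
  set D : ZMod m → ℂ := fun a => ∑ h ∈ Icc 1 H, ZMod.stdAddChar (a * (-(h : ZMod m))) with hD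
  have hF : ∀ a : ZMod m,
      ∑ x : ZMod m, (∑ h ∈ Icc 1 H, χ (x + (h : ZMod m))) * ZMod.stdAddChar (a * id x) =
      G a * D a := by
    intro a
    simp only [hG, hD, gaussSum, sum_mul, mul_sum, AddChar.mulShift_apply, id]
    rw [sum_comm]
    refine sum_congr rfl fun h _ => ?_
    refine Fintype.sum_equiv (Equiv.addRight (h : ZMod m)) _ _ fun x => ?_
    rw [Equiv.coe_addRight, mul_assoc, ← AddChar.map_add_eq_mul]
    congr 2
    ring
  have hP : ∑ a : ZMod m, ‖G a * D a‖ ^ 2 =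
      (m : ℝ) * ∑ x : ZMod m, ‖∑ h ∈ Icc 1 H, χ (x + (h : ZMod m))‖ ^ 2 := by
    have h := sum_norm_sq_stdAddChar_sum (m := m) univ
      (fun x => ∑ h ∈ Icc 1 H, χ (x + (h : ZMod m))) id
    simp_rw [hF] at h
    have h1 : ∀ x : ZMod m, (∑ h ∈ Icc 1 H, χ (x + (h : ZMod m))) *
        star (∑ h ∈ Icc 1 H, χ (x + (h : ZMod m))) =
        ((‖∑ h ∈ Icc 1 H, χ (x + (h : ZMod m))‖ ^ 2 : ℝ) : ℂ) := by
      intro x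
      rw [← starRingEnd_apply, Complex.mul_conj']
      push_cast
      rfl
    simp only [id, sum_ite_eq, mem_univ, if_true, h1] at h
    exact_mod_cast h
  have hG0 : G 0 = 0 := by
    simp only [hG, gaussSum, AddChar.mulShift_apply, zero_mul, AddChar.map_zero_eq_one, mul_one]
    exact MulChar.sum_eq_zero_of_ne_one hχ
  have hterm : ∀ a : ZMod m, ‖G a * D a‖ ^ 2 ≤
      m * ∑ d ∈ m.divisors, ∑ b : ZMod m,
        if (d : ZMod m) * b = a then (if a = 0 then 0 else ‖D a‖ ^ 2) else 0 := by
    intro a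
    by_cases ha : a = 0
    · simp only [ha, hG0, zero_mul, norm_zero, if_true, ite_self, sum_const_zero, mul_zero]
      norm_num
    · have h1 := norm_gaussSum_mulShift_sq_le χ a
      have h2 : (#{x : ZMod m | x * a = 0} : ℝ) ≤ (a.val.gcd m : ℕ) := by
        exact_mod_cast card_filter_mul_eq_zero_le a
      have h3 : ((a.val.gcd m : ℕ) : ℝ) * ‖D a‖ ^ 2 = ∑ b : ZMod m,
          if ((a.val.gcd m : ℕ) : ZMod m) * b = a then ‖D a‖ ^ 2 else 0 := by
        rw [← sum_filter, sum_const, card_filter_gcd_mul_eq, nsmul_eq_mul]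
      simp only [ha, if_false]
      have h4 : (∑ b : ZMod m, if ((a.val.gcd m : ℕ) : ZMod m) * b = a then ‖D a‖ ^ 2 else 0) ≤
          ∑ d ∈ m.divisors, ∑ b : ZMod m, if (d : ZMod m) * b = a then ‖D a‖ ^ 2 else 0 :=
        single_le_sum
          (f := fun d : ℕ => ∑ b : ZMod m, if (d : ZMod m) * b = a then ‖D a‖ ^ 2 else 0)
          (fun d _ => sum_nonneg fun b _ => by positivity)
          (Nat.mem_divisors.mpr ⟨Nat.gcd_dvd_right _ _, hm.ne'⟩)
      calc ‖G a * D a‖ ^ 2 = ‖G a‖ ^ 2 * ‖D a‖ ^ 2 := by rw [norm_mul, mul_pow]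
        _ ≤ (m * (a.val.gcd m : ℕ)) * ‖D a‖ ^ 2 := by
            gcongr
            exact h1.trans (by gcongr)
        _ = m * (((a.val.gcd m : ℕ) : ℝ) * ‖D a‖ ^ 2) := by ring
        _ ≤ _ := by rw [h3]; gcongr
  have hsum : ∑ a : ZMod m, ‖G a * D a‖ ^ 2 ≤ m * (#m.divisors * (m * H)) := by
    refine (sum_le_sum fun a _ => hterm a).trans ?_
    rw [← mul_sum]
    gcongr
    rw [sum_comm]
    rw [← nsmul_eq_mul]
    refine sum_le_card_nsmul _ _ _ fun d hd => ?_
    rw [sum_comm]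
    simp only [sum_ite_eq, mem_univ, if_true]
    exact sum_norm_sq_stdAddChar_natCast_mul_le (Nat.dvd_of_mem_divisors hd) H
  rw [hP] at hsum
  have := le_of_mul_le_mul_left hsum hm'
  linarith

/-- A Pólya–Vinogradov type bound valid for every nonprincipal character modulo `m`. -/
theorem mul_norm_charSum_le {m : ℕ} [NeZero m] {χ : DirichletCharacter ℂ m}
    (hχ : χ ≠ 1) {X : ℕ} (hX : X ≤ m) (H : ℕ) :
    H * ‖∑ n ∈ Icc 1 X, χ (n : ZMod m)‖ ≤ 2 * (H : ℝ) ^ 2 + √(X * (#m.divisors * m * H)) := by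
  set S := ∑ n ∈ Icc 1 X, χ (n : ZMod m) with hS
  have hshift : ∀ h : ℕ, ‖S - ∑ n ∈ Icc 1 X, χ ((n : ZMod m) + (h : ZMod m))‖ ≤ 2 * h := by
    intro h
    induction h with
    | zero => simp [hS]
    | succ h ih =>
      have h1 : (∑ n ∈ Icc 1 X, χ ((n : ZMod m) + ((h + 1 : ℕ) : ZMod m))) =
          (∑ n ∈ Icc 1 X, χ ((n : ZMod m) + (h : ZMod m))) +
            χ ((X : ZMod m) + ((h + 1 : ℕ) : ZMod m)) - χ (((1 + h : ℕ) : ZMod m)) := by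
        clear ih hS hX S
        induction X with
        | zero => simp [add_comm]
        | succ X ih =>
          rw [sum_Icc_succ_top (by omega), sum_Icc_succ_top (by omega), ih]
          push_cast
          rw [show (X : ZMod m) + 1 + h = X + (h + 1) by ring]
          ring
      rw [h1]
      have h2 := DirichletCharacter.norm_le_one χ ((X : ZMod m) + ((h + 1 : ℕ) : ZMod m))
      have h3 := DirichletCharacter.norm_le_one χ ((1 + h : ℕ) : ZMod m)
      calc _ = ‖(S - ∑ n ∈ Icc 1 X, χ ((n : ZMod m) + (h : ZMod m))) -
              χ ((X : ZMod m) + ((h + 1 : ℕ) : ZMod m)) + χ ((1 + h : ℕ) : ZMod m)‖ := by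
            congr 1; ring
        _ ≤ ‖S - ∑ n ∈ Icc 1 X, χ ((n : ZMod m) + (h : ZMod m))‖ +
              ‖χ ((X : ZMod m) + ((h + 1 : ℕ) : ZMod m))‖ + ‖χ ((1 + h : ℕ) : ZMod m)‖ :=
            (norm_add_le _ _).trans (add_le_add_left (norm_sub_le _ _) _)
        _ ≤ _ := by push_cast at *; linarith
  set F : ZMod m → ℂ := fun x => ∑ h ∈ Icc 1 H, χ (x + (h : ZMod m)) with hF
  have h1 : (H : ℂ) * S = (∑ h ∈ Icc 1 H, (S - ∑ n ∈ Icc 1 X, χ ((n : ZMod m) + (h : ZMod m)))) +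
      ∑ n ∈ Icc 1 X, F n := by
    rw [sum_sub_distrib, sum_const, Nat.card_Icc, Nat.add_sub_cancel, nsmul_eq_mul]
    simp only [hF]
    rw [sum_comm]
    ring
  have h2 : ‖∑ h ∈ Icc 1 H, (S - ∑ n ∈ Icc 1 X, χ ((n : ZMod m) + (h : ZMod m)))‖ ≤
      2 * (H : ℝ) ^ 2 := by
    refine (norm_sum_le _ _).trans ((sum_le_card_nsmul _ _ (2 * (H : ℝ)) fun h hh => ?_).trans ?_)
    · refine (hshift h).trans ?_
      have : (h : ℝ) ≤ H := by exact_mod_cast (mem_Icc.mp hh).2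
      linarith
    · rw [Nat.card_Icc, Nat.add_sub_cancel, nsmul_eq_mul]
      apply le_of_eq; ring
  have h3 : ‖∑ n ∈ Icc 1 X, F n‖ ≤ √(X * (#m.divisors * m * H)) := by
    apply Real.le_sqrt_of_sq_le
    calc ‖∑ n ∈ Icc 1 X, F n‖ ^ 2 ≤ (∑ n ∈ Icc 1 X, ‖F n‖) ^ 2 := by
          gcongr; exact norm_sum_le _ _
      _ ≤ #(Icc 1 X) * ∑ n ∈ Icc 1 X, ‖F n‖ ^ 2 := sq_sum_le_card_mul_sum_sq
      _ ≤ X * ∑ x : ZMod m, ‖F x‖ ^ 2 := by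
          rw [Nat.card_Icc, Nat.add_sub_cancel]
          gcongr
          have hinj : Set.InjOn (fun n : ℕ => (n : ZMod m)) (Icc 1 X : Finset ℕ) := by
            intro a ha b hb hab
            rw [mem_coe, mem_Icc] at ha hb
            have h5 : a ≡ b [MOD m] := (ZMod.natCast_eq_natCast_iff _ _ _).mp hab
            rcases Nat.lt_or_ge a m with h6 | h6
            · rcases Nat.lt_or_ge b m with h7 | h7
              · exact Nat.ModEq.eq_of_lt_of_lt h5 h6 h7
              · have hb' : b = m := by omega
                subst hb'
                have := (Nat.modEq_zero_iff_dvd.mp (h5.trans (by simp [Nat.ModEq])))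
                exact absurd (Nat.le_of_dvd (by omega) this) (by omega)
            · have ha' : a = m := by omega
              subst ha'
              have := (Nat.modEq_zero_iff_dvd.mp (h5.symm.trans (by simp [Nat.ModEq])))
              have := Nat.le_of_dvd (by omega) this
              omega
          rw [← sum_image (f := fun x => ‖F x‖ ^ 2) hinj]
          exact sum_le_sum_of_subset_of_nonneg (subset_univ _) fun _ _ _ => by positivity
      _ ≤ _ := by gcongr; exact sum_norm_sq_short_charSum_le hχ H
  calc H * ‖S‖ = ‖(H : ℂ) * S‖ := by rw [norm_mul, Complex.norm_natCast]
    _ ≤ _ := by rw [h1]; exact (norm_add_le _ _).trans (add_le_add h2 h3)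

theorem card_filter_coprime_dvd {m d : ℕ} (hd : 1 ≤ d) (X : ℕ) :
    #{n ∈ {n ∈ Icc 1 X | n.Coprime m} | d ∣ n} =
      if d.Coprime m then coprimeCount m (X / d) else 0 := by
  split_ifs with h
  · symm
    refine card_bij (fun k _ => d * k) ?_ ?_ ?_
    · intro k hk
      simp only [mem_filter, mem_Icc] at hk ⊢
      refine ⟨⟨⟨Nat.mul_pos hd hk.1.1, ?_⟩, h.mul_left hk.2⟩, dvd_mul_right _ _⟩
      exact (Nat.mul_le_mul_left d hk.1.2).trans (Nat.mul_div_le X d)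
    · intro a _ b _ hab
      exact Nat.eq_of_mul_eq_mul_left hd hab
    · intro n hn
      simp only [mem_filter, mem_Icc] at hn
      obtain ⟨⟨⟨h1, h2⟩, h3⟩, k, rfl⟩ := hn
      refine ⟨k, ?_, rfl⟩
      simp only [mem_filter, mem_Icc]
      refine ⟨⟨Nat.pos_of_mul_pos_left h1, ?_⟩, h3.coprime_mul_left⟩
      rw [Nat.le_div_iff_mul_le hd, mul_comm]
      exact h2
  · rw [card_eq_zero, filter_eq_empty_iff]
    intro n hn hdn
    exact h ((mem_filter.mp hn).2.coprime_dvd_left hdn)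

theorem sum_coprime_sum_vonMangoldt (m N X : ℕ) :
    ∑ n ∈ Icc 1 X with n.Coprime m, ∑ d ∈ Icc 1 N with d ∣ n, vonMangoldt d =
      ∑ d ∈ Icc 1 N with d.Coprime m, vonMangoldt d * coprimeCount m (X / d) := by
  simp_rw [sum_filter (s := Icc 1 N)]
  rw [sum_comm]
  refine sum_congr rfl fun d hd => ?_
  rw [← sum_filter, sum_const, card_filter_coprime_dvd (mem_Icc.mp hd).1, nsmul_eq_mul]
  split_ifs <;> push_cast <;> ring

theorem coprimeCount_one (X : ℕ) : coprimeCount 1 X = X := by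
  simp [coprimeCount]

theorem mul_log_sub_le_sum_log (N : ℕ) :
    N * Real.log N - N ≤ ∑ n ∈ Icc 1 N, Real.log n := by
  have h1 := Real.pow_div_factorial_le_exp (x := N) (by positivity) N
  rcases Nat.eq_zero_or_pos N with rfl | hN
  · simp
  have h2 : ∑ n ∈ Icc 1 N, Real.log n = Real.log N.factorial := by
    clear h1 hN
    induction N with
    | zero => simp
    | succ N ih =>
      rw [sum_Icc_succ_top (by omega), ih, Nat.factorial_succ, Nat.cast_mul,
        Real.log_mul (by positivity) (by positivity), add_comm]
  have h3 := Real.log_le_log (by positivity) h1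
  rw [Real.log_exp, Real.log_div (by positivity) (by positivity), Real.log_pow] at h3
  rw [h2]
  linarith

theorem sum_vonMangoldt_dvd_le {n : ℕ} (hn : n ≠ 0) (s : Finset ℕ) :
    ∑ d ∈ s with d ∣ n, vonMangoldt d ≤ Real.log n := by
  rw [← ArithmeticFunction.vonMangoldt_sum]
  refine sum_le_sum_of_subset_of_nonneg ?_ fun _ _ _ => ArithmeticFunction.vonMangoldt_nonneg
  intro d hd
  exact Nat.mem_divisors.mpr ⟨(mem_filter.mp hd).2, hn⟩

theorem log_sub_one_le_sum_vonMangoldt_div {N : ℕ} (hN : 1 ≤ N) :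
    Real.log N - 1 ≤ ∑ d ∈ Icc 1 N, vonMangoldt d / d := by
  have h1 := sum_coprime_sum_vonMangoldt 1 N N
  simp only [Nat.coprime_one_right_eq_true, filter_true, coprimeCount_one] at h1
  have h2 : ∑ n ∈ Icc 1 N, Real.log n ≤
      ∑ n ∈ Icc 1 N, ∑ d ∈ Icc 1 N with d ∣ n, vonMangoldt d := by
    refine sum_le_sum fun n hn => ?_
    rw [← ArithmeticFunction.vonMangoldt_sum]
    refine sum_le_sum_of_subset_of_nonneg ?_ fun _ _ _ => ArithmeticFunction.vonMangoldt_nonneg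
    intro d hd
    rw [mem_Icc] at hn
    have := Nat.divisor_le hd
    have := Nat.pos_of_mem_divisors hd
    exact mem_filter.mpr ⟨mem_Icc.mpr ⟨by omega, by omega⟩, Nat.dvd_of_mem_divisors hd⟩
  have h3 : ∑ d ∈ Icc 1 N, vonMangoldt d * ((N / d : ℕ) : ℝ) ≤
      N * ∑ d ∈ Icc 1 N, vonMangoldt d / d := by
    rw [mul_sum]
    refine sum_le_sum fun d _ => ?_
    calc vonMangoldt d * ((N / d : ℕ) : ℝ) ≤ vonMangoldt d * (N / d) := by
          gcongr
          exact Nat.cast_div_le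
      _ = _ := by ring
  have h4 := mul_log_sub_le_sum_log N
  have h5 : (0 : ℝ) < N := by exact_mod_cast hN
  refine le_of_mul_le_mul_left ?_ h5
  calc _ = N * Real.log N - N := by ring
    _ ≤ _ := h4.trans (h2.trans (h1.le.trans h3))

theorem sum_log_primeFactors_le {m : ℕ} (hm : m ≠ 0) :
    ∑ p ∈ m.primeFactors, Real.log p ≤ Real.log m := by
  rw [← Real.log_prod]
  · rw [← Nat.cast_prod]
    apply Real.log_le_log
    · exact_mod_cast Finset.prod_pos fun p hp => Nat.pos_of_mem_primeFactors hp
    · exact_mod_cast Nat.le_of_dvd (Nat.pos_of_ne_zero hm) (Nat.prod_primeFactors_dvd m)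
  · intro p hp
    exact_mod_cast (Nat.pos_of_mem_primeFactors hp).ne'

theorem sum_log_div_primeFactors_le {m : ℕ} (hm : m ≠ 0) {T : ℕ} (hT : 1 ≤ T) :
    ∑ p ∈ m.primeFactors, Real.log p / p ≤ T + Real.log m / T := by
  have hT' : (0 : ℝ) < T := by exact_mod_cast hT
  have h : ∀ p ∈ m.primeFactors, Real.log p / p ≤
      (if p ∈ Icc 1 T then 1 else 0) + Real.log p / T := by
    intro p hp
    have hp0 : (0 : ℝ) < p := by exact_mod_cast Nat.pos_of_mem_primeFactors hp
    have hl : 0 ≤ Real.log p := Real.log_natCast_nonneg p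
    split_ifs with h
    · have : Real.log p / p ≤ 1 := by
        rw [div_le_one hp0]
        exact (Real.log_le_sub_one_of_pos hp0).trans (by linarith)
      have : 0 ≤ Real.log p / T := by positivity
      linarith
    · rw [zero_add]
      rw [mem_Icc] at h
      have := Nat.pos_of_mem_primeFactors hp
      have : (T : ℝ) ≤ p := by exact_mod_cast (by omega : T ≤ p)
      gcongr
  refine (sum_le_sum h).trans ?_
  rw [sum_add_distrib, ← sum_div, sum_boole]
  gcongr
  · calc #{p ∈ m.primeFactors | p ∈ Icc 1 T} ≤ #(Icc 1 T) :=
        card_le_card fun p hp => (mem_filter.mp hp).2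
      _ = T := by simp
  · exact sum_log_primeFactors_le hm

theorem sum_inv_pow_le {p : ℝ} (hp : 2 ≤ p) (K : ℕ) :
    ∑ k ∈ Icc 1 K, (p ^ k)⁻¹ ≤ 2 / p * (1 - (p ^ K)⁻¹) := by
  have hp0 : 0 < p := by linarith
  induction K with
  | zero => simp
  | succ K ih =>
    rw [sum_Icc_succ_top (by omega)]
    have h1 : p⁻¹ ≤ 2⁻¹ := inv_anti₀ (by norm_num) hp
    have h2 : 0 < (p ^ K)⁻¹ * p⁻¹ := by positivity
    rw [div_eq_mul_inv] at *
    rw [pow_succ, mul_inv]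
    nlinarith [mul_le_mul_of_nonneg_left h1 h2.le]

theorem sum_vonMangoldt_div_not_coprime_le {m : ℕ} (hm : m ≠ 0) (N : ℕ) :
    ∑ d ∈ Icc 1 N with ¬ d.Coprime m, vonMangoldt d / d ≤
      2 * ∑ p ∈ m.primeFactors, Real.log p / p := by
  have h0 : ∀ d : ℕ, 0 ≤ vonMangoldt d / d := fun d =>
    div_nonneg ArithmeticFunction.vonMangoldt_nonneg (by positivity)
  have h1 : ∀ d ∈ {d ∈ Icc 1 N | ¬ d.Coprime m}, vonMangoldt d / d ≤
      ∑ x ∈ m.primeFactors ×ˢ Icc 1 N, if x.1 ^ x.2 = d then vonMangoldt d / d else 0 := by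
    intro d hd
    have hnn : ∀ x ∈ m.primeFactors ×ˢ Icc 1 N,
        0 ≤ if x.1 ^ x.2 = d then vonMangoldt d / d else 0 := by
      intro x _
      split_ifs
      exacts [h0 d, le_rfl]
    by_cases hp : IsPrimePow d
    · obtain ⟨p, k, hpp, hk, rfl⟩ := (isPrimePow_nat_iff d).mp hp
      simp only [mem_filter, mem_Icc] at hd
      have hx : (p, k) ∈ m.primeFactors ×ˢ Icc 1 N := by
        simp only [mem_product, mem_Icc, Nat.mem_primeFactors]
        refine ⟨⟨hpp, ?_, hm⟩, hk, ?_⟩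
        · by_contra h
          exact hd.2 (((Nat.Prime.coprime_iff_not_dvd hpp).mpr h).pow_left k)
        · exact (Nat.lt_pow_self hpp.one_lt).le.trans hd.1.2
      refine le_trans ?_ (single_le_sum hnn hx)
      simp
    · rw [ArithmeticFunction.vonMangoldt_eq_zero_iff.mpr hp]
      simp
  refine (sum_le_sum h1).trans ?_
  rw [sum_comm]
  have h2 : ∀ x ∈ m.primeFactors ×ˢ Icc 1 N,
      ∑ d ∈ Icc 1 N with ¬ d.Coprime m, (if x.1 ^ x.2 = d then vonMangoldt d / d else 0) ≤
        Real.log x.1 * ((x.1 : ℝ) ^ x.2)⁻¹ := by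
    intro x hx
    simp only [mem_product, mem_Icc, Nat.mem_primeFactors] at hx
    have hv : vonMangoldt (x.1 ^ x.2) / ((x.1 ^ x.2 : ℕ) : ℝ) =
        Real.log x.1 * ((x.1 : ℝ) ^ x.2)⁻¹ := by
      rw [ArithmeticFunction.vonMangoldt_apply_pow (by omega),
        ArithmeticFunction.vonMangoldt_apply_prime hx.1.1, Nat.cast_pow, div_eq_mul_inv]
    rw [sum_ite_eq]
    split_ifs
    · exact hv.le
    · rw [← hv]; exact h0 _
  refine (sum_le_sum h2).trans ?_
  rw [sum_product, mul_sum]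
  refine sum_le_sum fun p hp => ?_
  have hpp := Nat.prime_of_mem_primeFactors hp
  have hp2 : (2 : ℝ) ≤ p := by exact_mod_cast hpp.two_le
  dsimp only
  rw [← mul_sum]
  have h3 := sum_inv_pow_le hp2 N
  have h4 : 2 / (p : ℝ) * (1 - ((p : ℝ) ^ N)⁻¹) ≤ 2 / p * 1 := by
    gcongr
    have : 0 ≤ ((p : ℝ) ^ N)⁻¹ := by positivity
    linarith
  calc _ ≤ Real.log p * (2 / p * 1) := by
        gcongr
        exact h3.trans h4
    _ = _ := by ring

/-- The integers up to `X` coprime to `m` that have a prime factor exceeding `N`. -/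
def roughPart (m N X : ℕ) : Finset ℕ :=
  {n ∈ {n ∈ Icc 1 X | n.Coprime m} | ∃ p ∈ n.primeFactors, N < p}

theorem card_roughPart_mul_log_le {m N X : ℕ} (hN : 1 ≤ N) :
    #(roughPart m N X) * Real.log N ≤ coprimeCount m X * Real.log X -
      ∑ d ∈ Icc 1 N with d.Coprime m, vonMangoldt d * coprimeCount m (X / d) := by
  rw [← sum_coprime_sum_vonMangoldt, le_sub_iff_add_le]
  have hb : #(roughPart m N X) * Real.log N = ∑ n ∈ Icc 1 X with n.Coprime m,
      if ∃ p ∈ n.primeFactors, N < p then Real.log N else 0 := by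
    rw [roughPart, ← nsmul_eq_mul, ← sum_const, sum_filter]
  rw [hb, ← sum_add_distrib, coprimeCount, ← nsmul_eq_mul]
  refine sum_le_card_nsmul _ _ _ fun n hn => ?_
  simp only [mem_filter, mem_Icc] at hn
  have hn0 : n ≠ 0 := by omega
  have hlog : Real.log n ≤ Real.log X := by
    apply Real.log_le_log
    · exact_mod_cast hn.1.1
    · exact_mod_cast hn.1.2
  split_ifs with h
  · obtain ⟨p, hp, hNp⟩ := h
    have hpp := Nat.prime_of_mem_primeFactors hp
    have h1 := sum_vonMangoldt_dvd_le hn0 (insert p (Icc 1 N))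
    rw [filter_insert, if_pos (Nat.dvd_of_mem_primeFactors hp), sum_insert,
      ArithmeticFunction.vonMangoldt_apply_prime hpp] at h1
    · have : Real.log N ≤ Real.log p := by
        apply Real.log_le_log
        · exact_mod_cast hN
        · exact_mod_cast hNp.le
      linarith
    · simp only [mem_filter, mem_Icc]
      omega
  · rw [zero_add]
    exact (sum_vonMangoldt_dvd_le hn0 _).trans hlog

theorem card_roughPart_mul_log_le' {m N X T : ℕ} (hm : m ≠ 0) (hN : 1 ≤ N) (hT : 1 ≤ T) :
    #(roughPart m N X) * Real.log N ≤
      coprimeCount m X * (Real.log X - Real.log N + 1 + 2 * (T + Real.log m / T)) +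
        3 * #m.divisors * (N * Real.log N) := by
  refine (card_roughPart_mul_log_le hN).trans ?_
  have h1 : ∑ d ∈ Icc 1 N with d.Coprime m,
        vonMangoldt d * ((coprimeCount m X : ℝ) / d - 3 * #m.divisors) ≤
      ∑ d ∈ Icc 1 N with d.Coprime m, vonMangoldt d * coprimeCount m (X / d) := by
    refine sum_le_sum fun d hd => ?_
    have hd1 := (mem_Icc.mp (mem_filter.mp hd).1).1
    exact mul_le_mul_of_nonneg_left (coprimeCount_div_ge hm X hd1)
      ArithmeticFunction.vonMangoldt_nonneg
  have h2 : ∑ d ∈ Icc 1 N with d.Coprime m,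
        vonMangoldt d * ((coprimeCount m X : ℝ) / d - 3 * #m.divisors) =
      coprimeCount m X * (∑ d ∈ Icc 1 N with d.Coprime m, vonMangoldt d / d) -
        3 * #m.divisors * ∑ d ∈ Icc 1 N with d.Coprime m, vonMangoldt d := by
    rw [mul_sum, mul_sum, ← sum_sub_distrib]
    refine sum_congr rfl fun d _ => ?_
    ring
  have h3 : ∑ d ∈ Icc 1 N with d.Coprime m, vonMangoldt d ≤ N * Real.log N := by
    calc _ ≤ ∑ d ∈ Icc 1 N, vonMangoldt d :=
          sum_le_sum_of_subset_of_nonneg (filter_subset _ _)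
            fun _ _ _ => ArithmeticFunction.vonMangoldt_nonneg
      _ ≤ #(Icc 1 N) • Real.log N := by
          refine sum_le_card_nsmul _ _ _ fun d hd => ?_
          rw [mem_Icc] at hd
          refine ArithmeticFunction.vonMangoldt_le_log.trans (Real.log_le_log ?_ ?_)
          · exact_mod_cast hd.1
          · exact_mod_cast hd.2
      _ = _ := by simp
  have h4 := sum_filter_add_sum_filter_not (Icc 1 N) (fun d => d.Coprime m)
    (fun d => vonMangoldt d / d)
  have h5 := log_sub_one_le_sum_vonMangoldt_div hN
  have h6 := sum_vonMangoldt_div_not_coprime_le hm N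
  have h7 := sum_log_div_primeFactors_le hm hT
  have h8 : Real.log N - 1 - 2 * (T + Real.log m / T) ≤
      ∑ d ∈ Icc 1 N with d.Coprime m, vonMangoldt d / d := by linarith
  have h9 := mul_le_mul_of_nonneg_left h8 (Nat.cast_nonneg (α := ℝ) (coprimeCount m X))
  have h10 := mul_le_mul_of_nonneg_left h3
    (by positivity : (0 : ℝ) ≤ 3 * #m.divisors)
  linarith

theorem exists_mul_eq_of_primeFactors_le {n N : ℕ} (hn : n ≠ 0) (hN : 1 ≤ N) (hnN : n ^ 2 ≤ N ^ 3)
    (hp : ∀ p ∈ n.primeFactors, p ≤ N) : ∃ a b, a * b = n ∧ a ≤ N ∧ b ≤ N := by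
  have hne : {d ∈ n.divisors | d ≤ N}.Nonempty := ⟨1, by simp [hn, hN]⟩
  obtain ⟨d, hd, hmax⟩ := exists_max_image _ id hne
  rw [mem_filter, Nat.mem_divisors] at hd
  obtain ⟨⟨⟨e, rfl⟩, _⟩, hdN⟩ := hd
  by_cases he : e ≤ N
  · exact ⟨d, e, rfl, hdN, he⟩
  obtain ⟨p, hpp, f, rfl⟩ := Nat.exists_prime_and_dvd (n := e) (by omega)
  have hpN : p ≤ N := hp p (by
    rw [Nat.mem_primeFactors]
    exact ⟨hpp, ⟨d * f, by ring⟩, hn⟩)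
  by_cases hdf : d * f ≤ N
  · exact ⟨p, d * f, by ring, hpN, hdf⟩
  exfalso
  have h1 : N < d * p := by
    by_contra h
    have h2 := hmax (d * p) (by
      rw [mem_filter, Nat.mem_divisors]
      exact ⟨⟨⟨f, by ring⟩, hn⟩, by omega⟩)
    have hd0 : 0 < d := Nat.pos_of_ne_zero fun h => hn (by simp [h])
    have h3 := Nat.mul_lt_mul_of_pos_left hpp.one_lt hd0
    simp only [id, mul_one] at h2 h3
    omega
  push Not at he hdf
  have h4 : N * (N * N) < d * p * (p * f * (d * f)) :=
    Nat.mul_lt_mul'' h1 (Nat.mul_lt_mul'' he hdf)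
  have h5 : (d * (p * f)) ^ 2 = d * p * (p * f * (d * f)) := by ring
  have h6 : N ^ 3 = N * (N * N) := by ring
  omega

theorem exists_prod_eq_mul_prod {k N U J : ℕ} (hk : k ≠ 0) (hU : 1 ≤ U) (x : Fin k → ℕ)
    (hx : ∀ i, 1 ≤ x i ∧ x i ≤ N) (f : Fin J → ℕ) (hf : ∀ j, 1 ≤ f j ∧ f j ≤ U)
    (h : (∏ i, x i) * U ^ J * U ^ k ≤ N ^ k) (s : Finset (Fin J)) :
    ∃ y : Fin k → ℕ, (∀ i, 1 ≤ y i ∧ y i ≤ N) ∧ ∏ i, y i = (∏ i, x i) * ∏ j ∈ s, f j := by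
  induction s using Finset.induction_on with
  | empty => exact ⟨x, hx, by simp⟩
  | insert a s ha ih =>
    obtain ⟨y, hy, hprod⟩ := ih
    by_cases hi : ∃ i, y i * U ≤ N
    · obtain ⟨i, hi⟩ := hi
      refine ⟨Function.update y i (y i * f a), ?_, ?_⟩
      · intro j
        by_cases hj : j = i
        · subst hj
          rw [Function.update_self]
          exact ⟨Nat.mul_pos (hy j).1 (hf a).1,
            (Nat.mul_le_mul_left _ (hf a).2).trans hi⟩
        · rw [Function.update_of_ne hj]
          exact hy j
      · rw [prod_insert ha, mul_left_comm, ← hprod, prod_update_of_mem (mem_univ i),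
          ← mul_prod_erase univ y (mem_univ i), sdiff_singleton_eq_erase]
        ring
    · exfalso
      push Not at hi
      have h1 : (N + 1) ^ k ≤ ∏ i, (y i * U) := by
        calc (N + 1) ^ k = ∏ _i : Fin k, (N + 1) := by simp
          _ ≤ _ := prod_le_prod' fun i _ => hi i
      rw [prod_mul_distrib, prod_const, card_univ, Fintype.card_fin, hprod] at h1
      have h2 : ∏ j ∈ s, f j ≤ U ^ J := by
        calc ∏ j ∈ s, f j ≤ ∏ _j ∈ s, U := prod_le_prod' fun j _ => (hf j).2
          _ = U ^ #s := prod_const U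
          _ ≤ U ^ J := Nat.pow_le_pow_right hU ((card_le_univ s).trans_eq (Fintype.card_fin J))
      have h3 : N ^ k < (N + 1) ^ k := Nat.pow_lt_pow_left (Nat.lt_succ_self N) hk
      have h4 : (∏ i, x i) * (∏ j ∈ s, f j) * U ^ k ≤ (∏ i, x i) * U ^ J * U ^ k := by gcongr
      omega

theorem exists_six_factors {N X U J n₁ n₂ : ℕ} (hN : 1 ≤ N) (hU : 1 ≤ U)
    (hn₁ : 1 ≤ n₁ ∧ n₁ ≤ X) (hn₂ : 1 ≤ n₂ ∧ n₂ ≤ X)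
    (hp₁ : ∀ p ∈ n₁.primeFactors, p ≤ N) (hp₂ : ∀ p ∈ n₂.primeFactors, p ≤ N)
    (f : Fin J → ℕ) (hf : ∀ j, 1 ≤ f j ∧ f j ≤ U) (hXN : X ^ 2 ≤ N ^ 3)
    (hXU : X ^ 2 * U ^ J * U ^ 6 ≤ N ^ 6) :
    ∃ x : Fin 6 → ℕ, (∀ i, 1 ≤ x i ∧ x i ≤ N) ∧
      x 0 * x 1 * x 2 * x 3 * x 4 * x 5 = n₁ * n₂ * ∏ j, f j := by
  obtain ⟨a₁, b₁, rfl, ha₁, hb₁⟩ := exists_mul_eq_of_primeFactors_le (by omega) hN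
    ((Nat.pow_le_pow_left hn₁.2 2).trans hXN) hp₁
  obtain ⟨a₂, b₂, rfl, ha₂, hb₂⟩ := exists_mul_eq_of_primeFactors_le (by omega) hN
    ((Nat.pow_le_pow_left hn₂.2 2).trans hXN) hp₂
  have hprod : ∏ i, (![a₁, b₁, a₂, b₂, 1, 1] : Fin 6 → ℕ) i = a₁ * b₁ * (a₂ * b₂) := by
    simp [Fin.prod_univ_succ]
    ring
  obtain ⟨y, hy, hyp⟩ := exists_prod_eq_mul_prod (N := N) (by norm_num) hU ![a₁, b₁, a₂, b₂, 1, 1] (by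
      have h1 := Nat.pos_of_mul_pos_right hn₁.1
      have h2 := Nat.pos_of_mul_pos_left hn₁.1
      have h3 := Nat.pos_of_mul_pos_right hn₂.1
      have h4 := Nat.pos_of_mul_pos_left hn₂.1
      intro i
      fin_cases i <;> simp <;> omega) f hf (by
      rw [hprod]
      refine le_trans ?_ hXU
      gcongr
      rw [sq]
      exact Nat.mul_le_mul hn₁.2 hn₂.2) univ
  refine ⟨y, hy, ?_⟩
  rw [← hprod, ← hyp, Fin.prod_univ_six]

theorem card_filter_mul_prod_eq_le {k y : ℕ} (hy : y ≠ 0) (s : Finset ℕ)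
    (t : Finset ℕ) :
    #{z ∈ s ×ˢ Fintype.piFinset (fun _ : Fin k => t) | z.1 * ∏ j, z.2 j = y} ≤
      #y.divisors ^ (k + 1) := by
  calc _ ≤ #(y.divisors ×ˢ Fintype.piFinset (fun _ : Fin k => y.divisors)) := by
        refine card_le_card fun z hz => ?_
        have hz' := (mem_filter.mp hz).2
        simp only [mem_product, Fintype.mem_piFinset, Nat.mem_divisors]
        exact ⟨⟨⟨_, hz'.symm⟩, hy⟩, fun j =>
          ⟨(dvd_prod_of_mem _ (mem_univ j)).trans ⟨z.1, by rw [← hz', mul_comm]⟩, hy⟩⟩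
    _ = _ := by rw [card_product, Fintype.card_piFinset_const, pow_succ, mul_comm]

theorem card_filter_prod_eq_le {k y : ℕ} (hy : y ≠ 0) (t : Finset ℕ) :
    #{f ∈ Fintype.piFinset (fun _ : Fin k => t) | ∏ j, f j = y} ≤ #y.divisors ^ k := by
  calc _ ≤ #(Fintype.piFinset (fun _ : Fin k => y.divisors)) := by
        refine card_le_card fun z hz => ?_
        have hz' := (mem_filter.mp hz).2
        simp only [Fintype.mem_piFinset, Nat.mem_divisors]
        exact fun j => ⟨hz' ▸ dvd_prod_of_mem _ (mem_univ j), hy⟩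
    _ = _ := by rw [Fintype.card_piFinset_const]

theorem sum_char_pow_eq {m : ℕ} (χ : DirichletCharacter ℂ m) (t : Finset ℕ) (k : ℕ) :
    (∑ u ∈ t, χ (u : ZMod m)) ^ k =
      ∑ f ∈ Fintype.piFinset (fun _ : Fin k => t), χ ((∏ j, f j : ℕ) : ZMod m) := by
  have h := prod_univ_sum (fun _ : Fin k => t) (fun _ u => χ (u : ZMod m))
  rw [prod_const, card_univ, Fintype.card_fin] at h
  rw [h]
  refine sum_congr rfl fun f _ => ?_
  rw [Nat.cast_prod, map_prod]

theorem prod_mem_Icc {k U : ℕ} {f : Fin k → ℕ} (hf : ∀ j, f j ∈ Icc 1 U) :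
    ∏ j, f j ∈ Icc 1 (U ^ k) := by
  rw [mem_Icc]
  constructor
  · exact Nat.pos_of_ne_zero (prod_ne_zero_iff.mpr fun j _ => by
      have := (mem_Icc.mp (hf j)).1; omega)
  · calc ∏ j, f j ≤ ∏ _j : Fin k, U := prod_le_prod' fun j _ => (mem_Icc.mp (hf j)).2
      _ = U ^ k := by simp

theorem sum_norm_sq_mul_pow_le {m : ℕ} [NeZero m] {X U k D : ℕ} {s t : Finset ℕ}
    (hs : s ⊆ Icc 1 X) (ht : t ⊆ Icc 1 U) (a : ℕ → ℂ) (ha : ∀ n ∈ s, ‖a n‖ ≤ 1)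
    (hD : ∀ y ∈ Icc 1 (X * U ^ k), #y.divisors ^ (k + 1) ≤ D) (hm : m ≤ X * U ^ k) :
    ∑ χ : DirichletCharacter ℂ m,
      ‖(∑ n ∈ s, a n * χ (n : ZMod m)) * (∑ u ∈ t, χ (u : ZMod m)) ^ k‖ ^ 2 ≤
      2 * (D : ℝ) ^ 2 * ((X : ℝ) * (U : ℝ) ^ k) ^ 2 := by
  have h := sum_norm_sq_charSum_le (m := m) (s ×ˢ Fintype.piFinset (fun _ : Fin k => t))
    (fun z => a z.1) (fun z hz => ha _ (mem_product.mp hz).1) (fun z => z.1 * ∏ j, z.2 j)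
    (Y := X * U ^ k) (D := D) (fun z hz => ?_) (fun y hy => ?_) hm
  · refine le_of_eq_of_le ?_ (h.trans_eq (by push_cast; ring))
    refine sum_congr rfl fun χ _ => ?_
    refine congrArg (fun z : ℂ => ‖z‖ ^ 2) ?_
    rw [sum_char_pow_eq, sum_mul_sum, sum_product]
    refine sum_congr rfl fun n _ => sum_congr rfl fun f _ => ?_
    rw [Nat.cast_mul, map_mul, mul_assoc]
  · rw [mem_product, Fintype.mem_piFinset] at hz
    have h1 := mem_Icc.mp (hs hz.1)
    have h2 := mem_Icc.mp (prod_mem_Icc fun j => ht (hz.2 j))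
    exact mem_Icc.mpr ⟨Nat.mul_pos h1.1 h2.1, Nat.mul_le_mul h1.2 h2.2⟩
  · exact (card_filter_mul_prod_eq_le (by have := (mem_Icc.mp hy).1; omega) s t).trans (hD y hy)

theorem sum_norm_pow_le {m : ℕ} [NeZero m] {U k D : ℕ} {t : Finset ℕ} (ht : t ⊆ Icc 1 U)
    (hD : ∀ y ∈ Icc 1 (U ^ k), #y.divisors ^ k ≤ D) (hm : m ≤ U ^ k) :
    ∑ χ : DirichletCharacter ℂ m, ‖(∑ u ∈ t, χ (u : ZMod m)) ^ k‖ ^ 2 ≤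
      2 * (D : ℝ) ^ 2 * ((U : ℝ) ^ k) ^ 2 := by
  have h := sum_norm_sq_charSum_le (m := m) (Fintype.piFinset (fun _ : Fin k => t))
    (fun _ => 1) (fun _ _ => by simp) (fun z => ∏ j, z j)
    (Y := U ^ k) (D := D) (fun z hz => ?_) (fun y hy => ?_) hm
  · refine le_of_eq_of_le ?_ (h.trans_eq (by push_cast; ring))
    refine sum_congr rfl fun χ _ => ?_
    simp only [sum_char_pow_eq, one_mul]
  · exact prod_mem_Icc fun j => ht (Fintype.mem_piFinset.mp hz j)
  · exact (card_filter_prod_eq_le (by have := (mem_Icc.mp hy).1; omega) t).trans (hD y hy)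

theorem re_apply_one_le_sum_norm {m : ℕ} [NeZero m] {ι : Type*} (T : Finset ι) (c : ι → ℝ)
    (v : ι → ℕ) (lam : (ZMod m)ˣ) (hc : ∀ t ∈ T, ((v t : ℕ) : ZMod m) = lam → c t ≤ 0) :
    (∑ t ∈ T, (c t : ℂ) * (1 : DirichletCharacter ℂ m) (v t : ZMod m)).re ≤
      ∑ χ ∈ univ.erase (1 : DirichletCharacter ℂ m), ‖∑ t ∈ T, (c t : ℂ) * χ (v t : ZMod m)‖ := by
  set F : DirichletCharacter ℂ m → ℂ := fun χ => ∑ t ∈ T, (c t : ℂ) * χ (v t : ZMod m) with hF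
  have h1 : ∑ χ : DirichletCharacter ℂ m, χ (lam : ZMod m)⁻¹ * F χ =
      ((∑ t ∈ T, c t * (if (lam : ZMod m) = v t then (m.totient : ℝ) else 0) : ℝ) : ℂ) := by
    simp only [hF, mul_sum]
    rw [sum_comm]
    push_cast
    refine sum_congr rfl fun t _ => ?_
    have h2 := DirichletCharacter.sum_char_inv_mul_char_eq ℂ lam.isUnit (v t : ZMod m)
    calc _ = (c t : ℂ) * ∑ χ : DirichletCharacter ℂ m,
          χ (lam : ZMod m)⁻¹ * χ (v t : ZMod m) := by
          rw [mul_sum]; exact sum_congr rfl fun χ _ => by ring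
      _ = _ := by rw [h2]; split_ifs <;> simp
  have h3 : (∑ χ : DirichletCharacter ℂ m, χ (lam : ZMod m)⁻¹ * F χ).re ≤ 0 := by
    rw [h1, Complex.ofReal_re]
    refine sum_nonpos fun t ht => ?_
    split_ifs with h
    · exact mul_nonpos_of_nonpos_of_nonneg (hc t ht h.symm) (by positivity)
    · simp
  have h4 : (1 : DirichletCharacter ℂ m) (lam : ZMod m)⁻¹ = 1 := by
    rw [ZMod.inv_coe_unit]
    exact MulChar.one_apply_coe _
  rw [← add_sum_erase univ _ (mem_univ (1 : DirichletCharacter ℂ m)), h4, one_mul,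
    Complex.add_re] at h3
  have h5 : -(∑ χ ∈ univ.erase (1 : DirichletCharacter ℂ m), χ (lam : ZMod m)⁻¹ * F χ).re ≤
      ∑ χ ∈ univ.erase (1 : DirichletCharacter ℂ m), ‖F χ‖ := by
    refine (neg_le_abs _).trans ((Complex.abs_re_le_norm _).trans ((norm_sum_le _ _).trans ?_))
    refine sum_le_sum fun χ _ => ?_
    rw [norm_mul]
    exact mul_le_of_le_one_left (norm_nonneg _) (DirichletCharacter.norm_le_one χ _)
  change (F 1).re ≤ _
  linarith

theorem mul_mul_pow_le {i a q U R S X : ℝ} {k : ℕ} (hi : 0 ≤ i) (hiS : i ≤ S) (ha : 0 ≤ a)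
    (haX : a ≤ X) (hq : 0 ≤ q) (hqU : q ≤ U) (hU : 0 < U) (hR : 0 < R) :
    i * a * q ^ (2 * k + 1) ≤ U ^ (2 * k + 1) * (R⁻¹ * ((i * q ^ k) ^ 2 + (a * q ^ k) ^ 2) /
      (2 * U ^ (2 * k)) + S * X * R ^ (4 * k) * (q ^ (2 * k)) ^ 2 / U ^ (4 * k)) := by
  obtain ⟨w, rfl⟩ : ∃ w, q = w * U := ⟨q / U, by field_simp⟩
  have hw : 0 ≤ w := nonneg_of_mul_nonneg_left hq hU
  have hw1 : w ≤ 1 := by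
    by_contra h
    push Not at h
    nlinarith
  have hX : 0 ≤ X := ha.trans haX
  have hS : 0 ≤ S := hi.trans hiS
  have e1 : R⁻¹ * ((i * (w * U) ^ k) ^ 2 + (a * (w * U) ^ k) ^ 2) / (2 * U ^ (2 * k)) =
      R⁻¹ * w ^ (2 * k) * ((i ^ 2 + a ^ 2) / 2) := by
    field_simp
    ring
  have e2 : S * X * R ^ (4 * k) * ((w * U) ^ (2 * k)) ^ 2 / U ^ (4 * k) =
      S * X * (w * R) ^ (4 * k) := by
    field_simp
    ring
  rw [e1, e2, mul_pow]
  have h0 : 0 ≤ R⁻¹ * w ^ (2 * k) * ((i ^ 2 + a ^ 2) / 2) := by positivity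
  have h1 : 0 ≤ S * X * (w * R) ^ (4 * k) := by positivity
  have h2 : i * a ≤ (i ^ 2 + a ^ 2) / 2 := by nlinarith [sq_nonneg (i - a)]
  have hia : 0 ≤ i * a := by positivity
  suffices h : i * a * w ^ (2 * k + 1) ≤
      R⁻¹ * w ^ (2 * k) * ((i ^ 2 + a ^ 2) / 2) + S * X * (w * R) ^ (4 * k) by
    calc _ = U ^ (2 * k + 1) * (i * a * w ^ (2 * k + 1)) := by ring
      _ ≤ _ := by gcongr
  rcases le_total (w * R) 1 with h | h
  · have h3 : w ≤ R⁻¹ := by rwa [← one_div, le_div_iff₀ hR]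
    calc i * a * w ^ (2 * k + 1) = w * w ^ (2 * k) * (i * a) := by ring
      _ ≤ R⁻¹ * w ^ (2 * k) * ((i ^ 2 + a ^ 2) / 2) := by gcongr
      _ ≤ _ := by linarith
  · calc i * a * w ^ (2 * k + 1) ≤ S * X * 1 := by
          gcongr
          exact pow_le_one₀ hw hw1
      _ ≤ S * X * (w * R) ^ (4 * k) := by
          gcongr
          exact one_le_pow₀ h
      _ ≤ _ := by linarith

theorem sum_filter_coprime_char {m : ℕ} (χ : DirichletCharacter ℂ m) (X : ℕ) :
    ∑ n ∈ Icc 1 X with n.Coprime m, χ (n : ZMod m) = ∑ n ∈ Icc 1 X, χ (n : ZMod m) := by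
  refine sum_filter_of_ne fun n _ h => ?_
  by_contra hn
  exact h (MulChar.map_nonunit χ fun hu => hn ((ZMod.isUnit_iff_coprime n m).mp hu))

theorem sum_weight_mul_char_eq {m : ℕ} (χ : DirichletCharacter ℂ m) (s t : Finset ℕ) (b : ℕ → ℝ)
    (J : ℕ) :
    ∑ z ∈ (s ×ˢ s) ×ˢ Fintype.piFinset (fun _ : Fin J => t),
      ((1 - b z.1.1 - b z.1.2 : ℝ) : ℂ) * χ ((z.1.1 * z.1.2 * ∏ j, z.2 j : ℕ) : ZMod m) =
    (∑ n ∈ s, χ (n : ZMod m)) * (∑ n ∈ s, ((1 - 2 * b n : ℝ) : ℂ) * χ (n : ZMod m)) *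
      (∑ u ∈ t, χ (u : ZMod m)) ^ J := by
  set I := ∑ n ∈ s, χ (n : ZMod m) with hI
  set B := ∑ n ∈ s, (b n : ℂ) * χ (n : ZMod m) with hB
  have hA : ∑ n ∈ s, ((1 - 2 * b n : ℝ) : ℂ) * χ (n : ZMod m) = I - 2 * B := by
    rw [hI, hB, mul_sum, ← sum_sub_distrib]
    refine sum_congr rfl fun n _ => ?_
    push_cast
    ring
  have hIA : I * (I - 2 * B) = ∑ z ∈ s ×ˢ s,
      ((1 - b z.1 - b z.2 : ℝ) : ℂ) * (χ (z.1 : ZMod m) * χ (z.2 : ZMod m)) := by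
    have h1 : I * (I - 2 * B) = I * I - B * I - I * B := by ring
    rw [h1, hI, hB, sum_mul_sum, sum_mul_sum, sum_mul_sum, sum_product, ← sum_sub_distrib,
      ← sum_sub_distrib]
    refine sum_congr rfl fun x _ => ?_
    rw [← sum_sub_distrib, ← sum_sub_distrib]
    refine sum_congr rfl fun y _ => ?_
    push_cast
    ring
  rw [hA, hIA, sum_char_pow_eq, sum_mul_sum, sum_product]
  refine sum_congr rfl fun x _ => sum_congr rfl fun f _ => ?_
  dsimp only
  rw [Nat.cast_mul, Nat.cast_mul, map_mul, map_mul]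
  ring

theorem coprimeCount_mul_le_of_not_exists {m X U k N D : ℕ} [NeZero m] {S R : ℝ}
    (lam : (ZMod m)ˣ) (hk : 1 ≤ k) (hU : 1 ≤ U) (hX : m ≤ X * U ^ k) (hUm : m ≤ U ^ (2 * k))
    (hR : 0 < R) (hS0 : 0 ≤ S) (hS : ∀ χ : DirichletCharacter ℂ m, χ ≠ 1 →
      ‖∑ n ∈ Icc 1 X, χ (n : ZMod m)‖ ≤ S)
    (hD : ∀ y ∈ Icc 1 (X * U ^ (2 * k)), #y.divisors ≤ D)
    (hno : ∀ n₁ ∈ Icc 1 X, ∀ n₂ ∈ Icc 1 X, (∀ p ∈ n₁.primeFactors, p ≤ N) →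
      (∀ p ∈ n₂.primeFactors, p ≤ N) → ∀ f : Fin (2 * k + 1) → ℕ, (∀ j, f j ∈ Icc 1 U) →
      ((n₁ * n₂ * ∏ j, f j : ℕ) : ZMod m) ≠ lam) :
    (coprimeCount m X : ℝ) * (coprimeCount m X - 2 * #(roughPart m N X)) *
      (coprimeCount m U : ℝ) ^ (2 * k + 1) ≤
    2 * ((D : ℝ) ^ (2 * k)) ^ 2 * (U : ℝ) ^ (2 * k + 1) * X * (X / R + S * R ^ (4 * k)) := by
  set s : Finset ℕ := {n ∈ Icc 1 X | n.Coprime m} with hs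
  set t : Finset ℕ := {n ∈ Icc 1 U | n.Coprime m} with ht
  set b : ℕ → ℝ := fun n => if ∃ p ∈ n.primeFactors, N < p then 1 else 0 with hb
  have hX1 : 1 ≤ X := by
    by_contra h
    have : X = 0 := by omega
    subst this
    exact NeZero.ne m (by omega)
  have hD1 : 1 ≤ D := by
    have := hD 1 (mem_Icc.mpr ⟨le_rfl, Nat.mul_pos hX1 (pow_pos hU _)⟩)
    simpa using this
  have hUk : U ^ k ≤ U ^ (2 * k) := Nat.pow_le_pow_right hU (by omega)
  have h1 := re_apply_one_le_sum_norm (m := m)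
    ((s ×ˢ s) ×ˢ Fintype.piFinset (fun _ : Fin (2 * k + 1) => t))
    (fun z => 1 - b z.1.1 - b z.1.2) (fun z => z.1.1 * z.1.2 * ∏ j, z.2 j) lam (by
      rintro ⟨⟨n₁, n₂⟩, f⟩ hz hlam
      simp only [mem_product, Fintype.mem_piFinset] at hz
      have hh := hno n₁ (mem_filter.mp hz.1.1).1 n₂ (mem_filter.mp hz.1.2).1
      simp only [hb]
      by_cases h₁ : ∃ p ∈ n₁.primeFactors, N < p
      · rw [if_pos h₁]
        split_ifs <;> norm_num
      · by_cases h₂ : ∃ p ∈ n₂.primeFactors, N < p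
        · rw [if_neg h₁, if_pos h₂]
          norm_num
        · push Not at h₁ h₂
          exact absurd hlam (hh h₁ h₂ f fun j => (mem_filter.mp (hz.2 j)).1))
  simp only [sum_weight_mul_char_eq] at h1
  set a : ℕ → ℂ := fun n => ((1 - 2 * b n : ℝ) : ℂ) with ha
  have ha1 : ∀ n, ‖a n‖ ≤ 1 := by
    intro n
    simp only [ha, hb, Complex.norm_real, Real.norm_eq_abs]
    split_ifs
    all_goals norm_num
  have hone : ∀ n : ℕ, n.Coprime m → (1 : DirichletCharacter ℂ m) (n : ZMod m) = 1 :=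
    fun n hn => MulChar.one_apply ((ZMod.isUnit_iff_coprime n m).mpr hn)
  have hI1 : ∑ n ∈ s, (1 : DirichletCharacter ℂ m) (n : ZMod m) = (coprimeCount m X : ℂ) := by
    rw [sum_congr rfl fun n hn => hone n (mem_filter.mp hn).2, sum_const, nsmul_one, coprimeCount]
  have hQ1 : ∑ n ∈ t, (1 : DirichletCharacter ℂ m) (n : ZMod m) = (coprimeCount m U : ℂ) := by
    rw [sum_congr rfl fun n hn => hone n (mem_filter.mp hn).2, sum_const, nsmul_one, coprimeCount]
  have hA1 : ∑ n ∈ s, a n * (1 : DirichletCharacter ℂ m) (n : ZMod m) =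
      ((coprimeCount m X - 2 * #(roughPart m N X) : ℝ) : ℂ) := by
    rw [sum_congr rfl fun n hn => by rw [hone n (mem_filter.mp hn).2, mul_one]]
    simp only [ha]
    rw [← Complex.ofReal_sum, sum_sub_distrib, ← mul_sum]
    simp only [hb]
    rw [sum_boole, sum_const, nsmul_one, coprimeCount, roughPart]
  rw [hI1, hQ1, hA1] at h1
  have h2 : (((coprimeCount m X : ℕ) : ℂ) * ((coprimeCount m X - 2 * #(roughPart m N X) : ℝ) : ℂ) *
      ((coprimeCount m U : ℕ) : ℂ) ^ (2 * k + 1)).re = (coprimeCount m X : ℝ) *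
      (coprimeCount m X - 2 * #(roughPart m N X)) * (coprimeCount m U : ℝ) ^ (2 * k + 1) := by
    rw [← Complex.ofReal_re ((coprimeCount m X : ℝ) *
      (coprimeCount m X - 2 * #(roughPart m N X)) * (coprimeCount m U : ℝ) ^ (2 * k + 1))]
    push_cast
    rfl
  rw [h2] at h1
  refine h1.trans ?_
  have hcs : #s ≤ X := (card_filter_le _ _).trans_eq (by simp)
  have hct : #t ≤ U := (card_filter_le _ _).trans_eq (by simp)
  have hbound : ∀ (r : Finset ℕ) (Z : ℕ) (w : ℕ → ℂ) (χ : DirichletCharacter ℂ m), #r ≤ Z →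
      (∀ n, ‖w n‖ ≤ 1) → ‖∑ n ∈ r, w n * χ (n : ZMod m)‖ ≤ Z := by
    intro r Z w χ hr hw
    calc _ ≤ ∑ n ∈ r, (1 : ℝ) := by
          refine (norm_sum_le _ _).trans (sum_le_sum fun n _ => ?_)
          rw [norm_mul]
          exact mul_le_one₀ (hw n) (norm_nonneg _) (DirichletCharacter.norm_le_one χ _)
      _ ≤ Z := by
          rw [sum_const, nsmul_one]
          exact_mod_cast hr
  have hpt : ∀ χ ∈ univ.erase (1 : DirichletCharacter ℂ m),
      ‖(∑ n ∈ s, χ (n : ZMod m)) * (∑ n ∈ s, a n * χ (n : ZMod m)) *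
        (∑ u ∈ t, χ (u : ZMod m)) ^ (2 * k + 1)‖ ≤
      (U : ℝ) ^ (2 * k + 1) * (R⁻¹ *
        (‖(∑ n ∈ s, 1 * χ (n : ZMod m)) * (∑ u ∈ t, χ (u : ZMod m)) ^ k‖ ^ 2 +
        ‖(∑ n ∈ s, a n * χ (n : ZMod m)) * (∑ u ∈ t, χ (u : ZMod m)) ^ k‖ ^ 2) /
        (2 * (U : ℝ) ^ (2 * k)) + S * X * R ^ (4 * k) *
          ‖(∑ u ∈ t, χ (u : ZMod m)) ^ (2 * k)‖ ^ 2 / (U : ℝ) ^ (4 * k)) := by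
    intro χ hχ
    simp only [one_mul, norm_mul, norm_pow]
    refine mul_mul_pow_le (norm_nonneg _) ?_ (norm_nonneg _) (hbound s X a χ hcs ha1)
      (norm_nonneg _) ?_ (by exact_mod_cast hU) hR
    · rw [hs, sum_filter_coprime_char]
      exact hS χ (ne_of_mem_erase hχ)
    · have := hbound t U (fun _ => 1) χ hct (by simp)
      simpa using this
  refine (sum_le_sum hpt).trans ?_
  have hnn : ∀ g : DirichletCharacter ℂ m → ℂ,
      ∑ χ ∈ univ.erase (1 : DirichletCharacter ℂ m), ‖g χ‖ ^ 2 ≤ ∑ χ, ‖g χ‖ ^ 2 := fun g =>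
    sum_le_sum_of_subset_of_nonneg (subset_univ _) fun _ _ _ => by positivity
  have hDk : ∀ y ∈ Icc 1 (X * U ^ k), #y.divisors ^ (k + 1) ≤ D ^ (2 * k) := by
    intro y hy
    have hy' : y ∈ Icc 1 (X * U ^ (2 * k)) := by
      rw [mem_Icc] at hy ⊢
      exact ⟨hy.1, hy.2.trans (Nat.mul_le_mul_left X hUk)⟩
    exact (Nat.pow_le_pow_left (hD y hy') _).trans (Nat.pow_le_pow_right hD1 (by omega))
  have hD2k : ∀ y ∈ Icc 1 (U ^ (2 * k)), #y.divisors ^ (2 * k) ≤ D ^ (2 * k) := by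
    intro y hy
    have hy' : y ∈ Icc 1 (X * U ^ (2 * k)) := by
      rw [mem_Icc] at hy ⊢
      exact ⟨hy.1, hy.2.trans (Nat.le_mul_of_pos_left _ hX1)⟩
    exact Nat.pow_le_pow_left (hD y hy') _
  have m1 := (hnn _).trans (sum_norm_sq_mul_pow_le (m := m) (filter_subset _ _ : s ⊆ Icc 1 X)
    (filter_subset _ _ : t ⊆ Icc 1 U) (fun _ => 1) (fun _ _ => by simp) hDk hX)
  have m2 := (hnn _).trans (sum_norm_sq_mul_pow_le (m := m) (filter_subset _ _ : s ⊆ Icc 1 X)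
    (filter_subset _ _ : t ⊆ Icc 1 U) a (fun n _ => ha1 n) hDk hX)
  have m3 := (hnn _).trans (sum_norm_pow_le (m := m) (filter_subset _ _ : t ⊆ Icc 1 U) hD2k hUm)
  rw [← mul_sum, sum_add_distrib, ← sum_div, ← sum_div, ← mul_sum, ← mul_sum, sum_add_distrib]
  have hU0 : (0 : ℝ) < U := by exact_mod_cast hU
  have hX0 : (0 : ℝ) < X := by exact_mod_cast hX1
  push_cast at m1 m2 m3
  calc _ ≤ (U : ℝ) ^ (2 * k + 1) * (R⁻¹ *
        (2 * ((D : ℝ) ^ (2 * k)) ^ 2 * ((X : ℝ) * (U : ℝ) ^ k) ^ 2 +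
          2 * ((D : ℝ) ^ (2 * k)) ^ 2 * ((X : ℝ) * (U : ℝ) ^ k) ^ 2) / (2 * (U : ℝ) ^ (2 * k)) +
        S * X * R ^ (4 * k) * (2 * ((D : ℝ) ^ (2 * k)) ^ 2 * ((U : ℝ) ^ (2 * k)) ^ 2) /
          (U : ℝ) ^ (4 * k)) := by gcongr
    _ = _ := by
      field_simp
      ring

theorem half_le_floor {y : ℝ} (hy : 1 ≤ y) : y / 2 ≤ ⌊y⌋₊ := by
  have h1 := Nat.lt_floor_add_one y
  have h2 : (1 : ℝ) ≤ ⌊y⌋₊ := by exact_mod_cast Nat.one_le_floor_iff _ |>.mpr hy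
  linarith

theorem ceil_le_two_mul_of_one_le {y : ℝ} (hy : 1 ≤ y) : (⌈y⌉₊ : ℝ) ≤ 2 * y := by
  have h1 := Nat.ceil_lt_add_one (by linarith : 0 ≤ y)
  linarith

theorem norm_charSum_le_mul_inv {m X : ℕ} [NeZero m] {h g W : ℝ} (hh : h ^ 2 = m) (hh1 : 1 ≤ h)
    (hg : 16 ≤ g) (hW1 : 1 ≤ W) (hW : (#m.divisors : ℝ) ≤ W) (hWg : 4 * W ≤ g ^ 2)
    (hXm : X ≤ m) (hX : (X : ℝ) ≤ h * g ^ 4) (hX' : h * g ^ 4 / 2 ≤ X)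
    {χ : DirichletCharacter ℂ m} (hχ : χ ≠ 1) :
    ‖∑ n ∈ Icc 1 X, χ (n : ZMod m)‖ ≤ X * g⁻¹ := by
  have hg0 : 0 < g := by linarith
  have hh0 : 0 < h := by linarith
  have hhg : 1 ≤ h * g ^ 2 := one_le_mul_of_one_le_of_one_le hh1 (one_le_pow₀ (by linarith))
  set H := ⌈h * g ^ 2⌉₊ with hH
  have h1 : h * g ^ 2 ≤ H := Nat.le_ceil _
  have h2 : (H : ℝ) ≤ 2 * (h * g ^ 2) := ceil_le_two_mul_of_one_le hhg
  have hH0 : (0 : ℝ) < H := by linarith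
  have h3 := mul_norm_charSum_le hχ hXm H
  have h4 : √(X * (#m.divisors * m * H)) ≤ H * (W * g * h) := by
    apply Real.sqrt_le_iff.mpr
    refine ⟨by positivity, ?_⟩
    calc (X : ℝ) * (#m.divisors * m * H) ≤ (h * g ^ 4) * (W * h ^ 2 * H) := by
          rw [hh]; gcongr
      _ = (h * g ^ 2) * H * (g ^ 2 * h ^ 2) * W := by ring
      _ ≤ H * H * (g ^ 2 * h ^ 2) * (W * W) := by
          gcongr
          exact le_mul_of_one_le_left (by linarith) hW1
      _ = _ := by ring
  have h5 : ‖∑ n ∈ Icc 1 X, χ (n : ZMod m)‖ ≤ 2 * H + W * g * h := by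
    refine le_of_mul_le_mul_left ?_ hH0
    calc _ ≤ _ := h3
      _ ≤ 2 * (H : ℝ) ^ 2 + H * (W * g * h) := by gcongr
      _ = _ := by ring
  refine h5.trans ?_
  rw [le_mul_inv_iff₀ hg0]
  calc (2 * H + W * g * h) * g ≤ (2 * (2 * (h * g ^ 2)) + g ^ 2 / 4 * g * h) * g := by
        gcongr
        linarith
    _ = h * g ^ 3 * (4 + g / 4) := by ring
    _ ≤ h * g ^ 3 * (g / 2) := by
        gcongr
        linarith
    _ = h * g ^ 4 / 2 := by ring
    _ ≤ X := hX'

theorem div_two_mul_le_coprimeCount {m Z : ℕ} (hm : m ≠ 0) {W : ℝ}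
    (hW : (#m.divisors : ℝ) ≤ W) (hZ : 2 * W ^ 2 ≤ Z) :
    (Z : ℝ) / (2 * W) ≤ coprimeCount m Z := by
  refine le_trans ?_ (le_coprimeCount hm Z)
  have ht : (0 : ℝ) < #m.divisors := by
    exact_mod_cast card_pos.mpr (Nat.nonempty_divisors.mpr hm)
  have hW0 : 0 < W := by linarith
  have h1 : (Z : ℝ) / W ≤ Z / #m.divisors := by gcongr
  have h2 : (Z : ℝ) / (2 * W) = Z / W / 2 := by field_simp
  have h3 : W ≤ Z / W / 2 := by
    rw [le_div_iff₀ (by norm_num), le_div_iff₀ hW0]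
    linarith
  linarith

theorem two_mul_card_roughPart_le {m X N T : ℕ} {ε W : ℝ} (hm : m ≠ 0) (hε : 0 < ε)
    (hε1 : ε ≤ 1 / 10) (hW : (#m.divisors : ℝ) ≤ W) (hT : 1 ≤ T) (hTε : 32 / ε ≤ T)
    (hN : 1 ≤ N) (hX : Real.log X ≤ (1 / 2 + ε) * Real.log m)
    (hN' : (1 / 3 + ε) * Real.log m - 1 ≤ Real.log N)
    (hN'' : Real.log N ≤ Real.log m)
    (hL : 2 + 2 * T ≤ ε / 16 * Real.log m)
    (hNX : 3 * W * N ≤ ε / 16 * coprimeCount m X) :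
    (2 * #(roughPart m N X) : ℝ) ≤ (1 - ε / 2) * coprimeCount m X := by
  set L := Real.log m with hLdef
  set I : ℝ := (coprimeCount m X : ℝ) with hI
  set B : ℝ := (#(roughPart m N X) : ℝ) with hB
  have hB0 : 0 ≤ B := by positivity
  have hI0 : 0 ≤ I := by positivity
  have hT' : (1 : ℝ) ≤ T := by exact_mod_cast hT
  have hT0 : (0 : ℝ) < T := by linarith
  have hL0 : 0 < L := by
    by_contra h
    push Not at h
    nlinarith
  have h1 := card_roughPart_mul_log_le' (X := X) hm hN hT
  have h2 : L / T ≤ ε / 32 * L := by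
    rw [div_le_iff₀ hT0]
    have : 32 ≤ T * ε := by rwa [div_le_iff₀ hε] at hTε
    nlinarith
  have h3 : 3 * (#m.divisors : ℝ) * (N * Real.log N) ≤ ε / 16 * I * L := by
    have hN0 : 0 ≤ Real.log N := Real.log_natCast_nonneg N
    have hW0 : 0 ≤ W := le_trans (by positivity) hW
    calc 3 * (#m.divisors : ℝ) * (N * Real.log N) ≤ 3 * W * (N * L) := by gcongr
      _ = 3 * W * N * L := by ring
      _ ≤ _ := by gcongr
  have h4 : I * (Real.log X - Real.log N + 1 + 2 * (T + L / T)) ≤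
      I * ((1 / 6 + ε / 8) * L) := by
    gcongr
    linarith
  have h5 : B * ((1 / 3 + ε - ε / 16) * L) ≤ B * Real.log N := by
    gcongr
    nlinarith
  have h6 : (B * (1 / 3 + ε - ε / 16)) * L ≤ (I * (1 / 6 + ε / 8 + ε / 16)) * L := by
    calc _ = B * ((1 / 3 + ε - ε / 16) * L) := by ring
      _ ≤ _ := h5.trans h1
      _ ≤ I * ((1 / 6 + ε / 8) * L) + ε / 16 * I * L := add_le_add h4 h3
      _ = _ := by ring
  have h7 := le_of_mul_le_mul_right h6 hL0
  have h8 : 0 < 1 / 3 + ε - ε / 16 := by linarith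
  have h9 : 2 * (1 / 6 + ε / 8 + ε / 16) ≤ (1 - ε / 2) * (1 / 3 + ε - ε / 16) := by nlinarith
  refine le_of_mul_le_mul_right ?_ h8
  calc _ = 2 * (B * (1 / 3 + ε - ε / 16)) := by ring
    _ ≤ 2 * (I * (1 / 6 + ε / 8 + ε / 16)) := by gcongr
    _ = I * (2 * (1 / 6 + ε / 8 + ε / 16)) := by ring
    _ ≤ I * ((1 - ε / 2) * (1 / 3 + ε - ε / 16)) := by gcongr
    _ = _ := by ring

theorem not_main_le_error {X U k D : ℕ} {ε W R S I V B : ℝ} (hε : 0 < ε) (hW1 : 1 ≤ W)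
    (hX : 0 < X) (hU : 0 < U) (hD : (D : ℝ) ≤ W) (hI : X / (2 * W) ≤ I) (hV : U / (2 * W) ≤ V)
    (hB : B ≤ (1 - ε / 2) * I) (hR : 0 < R) (hS0 : 0 ≤ S) (hS : S * R ^ (4 * k) ≤ X / R)
    (hRW : 8 * 2 ^ (2 * k + 3) * W ^ (6 * k + 3) < ε * R) :
    ¬ I * (I - B) * V ^ (2 * k + 1) ≤
      2 * ((D : ℝ) ^ (2 * k)) ^ 2 * (U : ℝ) ^ (2 * k + 1) * X * (X / R + S * R ^ (4 * k)) := by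
  intro h
  have hX' : (0 : ℝ) < X := by exact_mod_cast hX
  have hU' : (0 : ℝ) < U := by exact_mod_cast hU
  have hW0 : 0 < W := by linarith
  have hI0 : 0 < I := lt_of_lt_of_le (by positivity) hI
  have h1 : (X / (2 * W)) * (ε / 2 * (X / (2 * W))) * (U / (2 * W)) ^ (2 * k + 1) ≤
      I * (I - B) * V ^ (2 * k + 1) := by
    have h0 : ε / 2 * (X / (2 * W)) ≤ I - B := by
      calc ε / 2 * (X / (2 * W)) ≤ ε / 2 * I := by gcongr
        _ ≤ I - B := by linarith
    have hV0 : 0 ≤ U / (2 * W) := by positivity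
    exact mul_le_mul (mul_le_mul hI h0 (by positivity) hI0.le) (pow_le_pow_left₀ hV0 hV _)
      (by positivity) (mul_nonneg hI0.le (le_trans (by positivity) h0))
  have h2 : 2 * ((D : ℝ) ^ (2 * k)) ^ 2 * (U : ℝ) ^ (2 * k + 1) * X * (X / R + S * R ^ (4 * k)) ≤
      2 * (W ^ (2 * k)) ^ 2 * (U : ℝ) ^ (2 * k + 1) * X * (X / R + X / R) := by
    gcongr
  have h3 := h1.trans (h.trans h2)
  have h4 : (X / (2 * W)) * (ε / 2 * (X / (2 * W))) * (U / (2 * W)) ^ (2 * k + 1) =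
      (ε * R) * ((X : ℝ) ^ 2 * U ^ (2 * k + 1) / (2 * R * (2 * W) ^ (2 * k + 3))) := by
    have hP : 0 < 2 * W := by positivity
    generalize 2 * W = P at hP
    rw [div_pow]
    field_simp
    ring
  have h5 : 2 * (W ^ (2 * k)) ^ 2 * (U : ℝ) ^ (2 * k + 1) * X * (X / R + X / R) =
      (8 * 2 ^ (2 * k + 3) * W ^ (6 * k + 3)) *
        ((X : ℝ) ^ 2 * U ^ (2 * k + 1) / (2 * R * (2 * W) ^ (2 * k + 3))) := by
    field_simp
    ring
  rw [h4, h5] at h3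
  exact absurd (le_of_mul_le_mul_right h3 (by positivity)) (not_le.mpr hRW)

set_option maxHeartbeats 1000000 in
theorem exists_six_factors_of_bounds {m k T : ℕ} [NeZero m] {ε W R g h n u : ℝ}
    (hk : 1 ≤ k) (hε : 0 < ε) (hε1 : ε ≤ 1 / 10) (hT : 1 ≤ T) (hTε : 32 / ε ≤ T)
    (hR : 0 < R) (hRg : R ^ (4 * k + 1) = g) (hh : h ^ 2 = m) (hh1 : 1 ≤ h)
    (hn : n ^ 3 = m) (hn1 : 1 ≤ n) (hu : u ^ k = h) (hu1 : 1 ≤ u)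
    (hlh : Real.log h = 1 / 2 * Real.log m) (hlg : Real.log g = ε / 4 * Real.log m)
    (hln : Real.log n = 1 / 3 * Real.log m)
    (hug : u ≤ g) (hkg : 2 ^ (2 * k + 13) ≤ g) (hgh : g ^ 4 ≤ h)
    (hW1 : 1 ≤ W) (hWd : ∀ y : ℕ, 1 ≤ y → y ≤ m ^ 3 → (#y.divisors : ℝ) ≤ W)
    (hWg : 4 * W ≤ g ^ 2) (hWh : 4 * W ^ 2 ≤ h) (hWu : 2 * W ^ 2 ≤ u)
    (hWn : 192 * W ^ 2 * n ≤ ε * h) (hL : 2 + 2 * T ≤ ε / 16 * Real.log m)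
    (hWR : 8 * 2 ^ (2 * k + 3) * W ^ (6 * k + 3) < ε * R) (lam : (ZMod m)ˣ) :
    ∃ x : Fin 6 → ℕ, (∀ i, 1 ≤ x i ∧ (x i : ℝ) ≤ n * g ^ 4) ∧
      (lam : ZMod m) = ((x 0 * x 1 * x 2 * x 3 * x 4 * x 5 : ℕ) : ZMod m) := by
  have hm0 : m ≠ 0 := NeZero.ne m
  have hm1 : 1 ≤ m := Nat.one_le_iff_ne_zero.mpr hm0
  have hg13 : (2 : ℝ) ^ 13 ≤ g := le_trans (pow_le_pow_right₀ (by norm_num) (by omega)) hkg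
  have hg : 16 ≤ g := le_trans (by norm_num) hg13
  have hg0 : 0 < g := by linarith
  have hg1 : 1 ≤ g := by linarith
  have hh0 : 0 < h := by linarith
  have hn0 : 0 < n := by linarith
  have hW0 : 0 < W := by linarith
  have hhg : 1 ≤ h * g ^ 4 := one_le_mul_of_one_le_of_one_le hh1 (one_le_pow₀ hg1)
  have hng : 1 ≤ n * g ^ 4 := one_le_mul_of_one_le_of_one_le hn1 (one_le_pow₀ hg1)
  set X := ⌊h * g ^ 4⌋₊ with hXdef
  set N := ⌊n * g ^ 4⌋₊ with hNdef
  set U := ⌈u⌉₊ with hUdef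
  have hX1 : (X : ℝ) ≤ h * g ^ 4 := Nat.floor_le (by positivity)
  have hX2 : h * g ^ 4 / 2 ≤ X := half_le_floor hhg
  have hN1 : (N : ℝ) ≤ n * g ^ 4 := Nat.floor_le (by positivity)
  have hN2 : n * g ^ 4 / 2 ≤ N := half_le_floor hng
  have hU1 : u ≤ U := Nat.le_ceil u
  have hU2 : (U : ℝ) ≤ 2 * u := ceil_le_two_mul_of_one_le hu1
  have hXpos : 1 ≤ X := Nat.one_le_floor_iff _ |>.mpr hhg
  have hNpos : 1 ≤ N := Nat.one_le_floor_iff _ |>.mpr hng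
  have hUpos : 1 ≤ U := by
    have : (1 : ℝ) ≤ U := hu1.trans hU1
    exact_mod_cast this
  have hXpos' : (0 : ℝ) < X := by exact_mod_cast hXpos
  have hXm : X ≤ m := by
    have : (X : ℝ) ≤ m := by
      rw [← hh, sq]
      exact hX1.trans (by gcongr)
    exact_mod_cast this
  have hUk : h ≤ (U : ℝ) ^ k := by rw [← hu]; gcongr
  have hg4 : 16 ≤ g ^ 4 := hg.trans (le_self_pow₀ hg1 (by norm_num))
  have hXU : m ≤ X * U ^ k := by
    have : (m : ℝ) ≤ X * (U : ℝ) ^ k := by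
      calc (m : ℝ) = h * 2 / 2 * h := by rw [← hh]; ring
        _ ≤ h * g ^ 4 / 2 * h := by gcongr; linarith
        _ ≤ X * (U : ℝ) ^ k := by gcongr
    exact_mod_cast this
  have hUm : m ≤ U ^ (2 * k) := by
    have : (m : ℝ) ≤ (U : ℝ) ^ (2 * k) := by
      rw [mul_comm, pow_mul, ← hh]
      gcongr
    exact_mod_cast this
  have hu2k : u ^ (2 * k) = m := by rw [mul_comm, pow_mul, hu, hh]
  have hXN : X ^ 2 ≤ N ^ 3 := by
    have : (X : ℝ) ^ 2 ≤ (N : ℝ) ^ 3 := by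
      calc (X : ℝ) ^ 2 ≤ (h * g ^ 4) ^ 2 := by gcongr
        _ = m * g ^ 8 * 1 := by rw [← hh]; ring
        _ ≤ m * g ^ 8 * (g ^ 4 / 8) := by gcongr; linarith
        _ = (n * g ^ 4 / 2) ^ 3 := by rw [← hn]; ring
        _ ≤ _ := by gcongr
    exact_mod_cast this
  have hXUN : X ^ 2 * U ^ (2 * k + 1) * U ^ 6 ≤ N ^ 6 := by
    have : (X : ℝ) ^ 2 * (U : ℝ) ^ (2 * k + 1) * (U : ℝ) ^ 6 ≤ (N : ℝ) ^ 6 := by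
      calc (X : ℝ) ^ 2 * (U : ℝ) ^ (2 * k + 1) * (U : ℝ) ^ 6
          ≤ (h * g ^ 4) ^ 2 * (2 * u) ^ (2 * k + 1) * (2 * u) ^ 6 := by gcongr
        _ = h ^ 2 * u ^ (2 * k) * g ^ 8 * (u ^ 7 * 2 ^ (2 * k + 13)) / 64 := by ring
        _ ≤ h ^ 2 * u ^ (2 * k) * g ^ 8 * (g ^ 7 * g) / 64 := by gcongr
        _ = m * m * g ^ 16 / 64 * 1 := by rw [hh, hu2k]; ring
        _ ≤ m * m * g ^ 16 / 64 * g ^ 8 := by gcongr; exact one_le_pow₀ hg1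
        _ = (n * g ^ 4 / 2) ^ 6 := by
          have : n ^ 6 = m * m := by rw [← hn]; ring
          rw [← this]; ring
        _ ≤ _ := by gcongr
    exact_mod_cast this
  have hW : (#m.divisors : ℝ) ≤ W := hWd m hm1 (Nat.le_self_pow (by norm_num) m)
  have h2km : (2 : ℝ) ^ (2 * k) ≤ m := by
    calc (2 : ℝ) ^ (2 * k) ≤ 2 ^ (2 * k + 13) := pow_le_pow_right₀ (by norm_num) (by omega)
      _ ≤ g := hkg
      _ ≤ g ^ 4 := le_self_pow₀ hg1 (by norm_num)
      _ ≤ h := hgh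
      _ ≤ h ^ 2 := le_self_pow₀ hh1 (by norm_num)
      _ = m := hh
  have hD : ∀ y ∈ Icc 1 (X * U ^ (2 * k)), #y.divisors ≤ ⌊W⌋₊ := by
    intro y hy
    rw [mem_Icc] at hy
    refine Nat.le_floor (hWd y hy.1 (hy.2.trans ?_))
    have : (X : ℝ) * (U : ℝ) ^ (2 * k) ≤ (m : ℝ) ^ 3 := by
      calc (X : ℝ) * (U : ℝ) ^ (2 * k) ≤ m * (2 * u) ^ (2 * k) := by gcongr
        _ = m * (2 ^ (2 * k) * m) := by rw [mul_pow, hu2k]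
        _ ≤ m * (m * m) := by gcongr
        _ = _ := by ring
    exact_mod_cast this
  have hlogX : Real.log X ≤ (1 / 2 + ε) * Real.log m := by
    refine (Real.log_le_log hXpos' hX1).trans_eq ?_
    rw [Real.log_mul hh0.ne' (by positivity), Real.log_pow, hlh, hlg]
    push_cast
    ring
  have hlogng : Real.log (n * g ^ 4) = (1 / 3 + ε) * Real.log m := by
    rw [Real.log_mul hn0.ne' (by positivity), Real.log_pow, hln, hlg]
    push_cast
    ring
  have hL0 : 0 ≤ Real.log m := Real.log_natCast_nonneg m
  have hlogN : (1 / 3 + ε) * Real.log m - 1 ≤ Real.log N := by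
    refine le_trans ?_ (Real.log_le_log (by positivity) hN2)
    rw [Real.log_div (by positivity) (by norm_num), hlogng]
    have := Real.log_two_lt_d9
    linarith
  have hlogN' : Real.log N ≤ Real.log m := by
    refine (Real.log_le_log (by exact_mod_cast hNpos) hN1).trans ?_
    rw [hlogng]
    exact mul_le_of_le_one_left hL0 (by linarith)
  have hIX : (X : ℝ) / (2 * W) ≤ coprimeCount m X := by
    refine div_two_mul_le_coprimeCount hm0 hW (le_trans ?_ hX2)
    have := le_mul_of_one_le_right hh0.le (one_le_pow₀ hg1 : 1 ≤ g ^ 4)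
    linarith
  have hIU : (U : ℝ) / (2 * W) ≤ coprimeCount m U :=
    div_two_mul_le_coprimeCount hm0 hW (hWu.trans hU1)
  have hNX : 3 * W * N ≤ ε / 16 * coprimeCount m X := by
    calc 3 * W * N ≤ 3 * W * (n * g ^ 4) := by gcongr
      _ = 192 * W ^ 2 * n * (g ^ 4 / (64 * W)) := by field_simp; ring
      _ ≤ ε * h * (g ^ 4 / (64 * W)) := by gcongr
      _ = ε / 16 * (h * g ^ 4 / 2 / (2 * W)) := by field_simp; ring
      _ ≤ ε / 16 * (X / (2 * W)) := by gcongr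
      _ ≤ _ := by gcongr
  have hrough := two_mul_card_roughPart_le hm0 hε hε1 hW hT hTε hNpos hlogX hlogN hlogN' hL hNX
  have hmain := not_main_le_error (S := X * g⁻¹) (k := k) hε hW1 hXpos hUpos
    (Nat.floor_le hW0.le) hIX hIU hrough hR (by positivity) (by
      apply le_of_eq
      rw [← hRg]
      field_simp
      exact (pow_succ R (4 * k)).symm) hWR
  by_contra hno
  refine hmain (coprimeCount_mul_le_of_not_exists lam hk hUpos hXU hUm hR (by positivity)
    (fun χ hχ => norm_charSum_le_mul_inv hh hh1 hg hW1 hW hWg hXm hX1 hX2 hχ) hD ?_)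
  intro n₁ hn₁ n₂ hn₂ hp₁ hp₂ f hf hlam
  obtain ⟨x, hx, hprod⟩ := exists_six_factors hNpos hUpos (mem_Icc.mp hn₁) (mem_Icc.mp hn₂)
    hp₁ hp₂ f (fun j => mem_Icc.mp (hf j)) hXN hXUN
  refine hno ⟨x, fun i => ⟨(hx i).1, le_trans ?_ hN1⟩, ?_⟩
  · exact_mod_cast (hx i).2
  · rw [hprod, hlam]

theorem eventually_const_mul_rpow_lt (K : ℝ) {a b : ℝ} (hab : a < b) :
    ∀ᶠ m : ℕ in Filter.atTop, K * (m : ℝ) ^ a < (m : ℝ) ^ b := by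
  have h1 := ((tendsto_rpow_atTop (sub_pos.mpr hab)).comp
    tendsto_natCast_atTop_atTop).eventually_gt_atTop K
  filter_upwards [h1, Filter.eventually_ge_atTop 1] with m hm hm1
  have hm0 : (0 : ℝ) < m := by exact_mod_cast hm1
  have h2 : (0 : ℝ) < (m : ℝ) ^ a := by positivity
  calc K * (m : ℝ) ^ a < (m : ℝ) ^ (b - a) * (m : ℝ) ^ a := by gcongr; exact hm
    _ = _ := by rw [← Real.rpow_add hm0]; congr 1; ring

theorem eventually_exists_six_factors {ε : ℝ} (hε : 0 < ε) (hε1 : ε ≤ 1 / 10) :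
    ∀ᶠ m : ℕ in Filter.atTop, ∀ lam : (ZMod m)ˣ,
      ∃ x : Fin 6 → ℕ, (∀ i, 1 ≤ x i ∧ (x i : ℝ) ≤ (m : ℝ) ^ ((1 : ℝ) / 3 + ε)) ∧
        (lam : ZMod m) = ((x 0 * x 1 * x 2 * x 3 * x 4 * x 5 : ℕ) : ZMod m) := by
  obtain ⟨k, hk⟩ := exists_nat_ge (2 / ε)
  have hk0 : (0 : ℝ) < k := lt_of_lt_of_le (by positivity) hk
  have hk1 : 1 ≤ k := by exact_mod_cast hk0
  have hk1' : (1 : ℝ) ≤ k := by exact_mod_cast hk1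
  obtain ⟨T, hT⟩ := exists_nat_ge (32 / ε)
  have hT1 : 1 ≤ T := by
    have : (0 : ℝ) < T := lt_of_lt_of_le (by positivity) hT
    exact_mod_cast this
  obtain ⟨c, hc⟩ : ∃ c : ℝ, c = ε / (4 * (4 * k + 1)) := ⟨_, rfl⟩
  have hc0 : 0 < c := by rw [hc]; positivity
  have hck : c * (4 * k + 1) = ε / 4 := by rw [hc]; field_simp
  have hcε : c * 5 ≤ ε / 4 := by rw [← hck]; gcongr; linarith
  obtain ⟨ρ, hρ⟩ : ∃ ρ : ℝ, ρ = c / (6 * (6 * k + 3)) := ⟨_, rfl⟩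
  have hρ0 : 0 < ρ := by rw [hρ]; positivity
  have hρk : 3 * ρ * (6 * k + 3) = c / 2 := by rw [hρ]; field_simp; ring
  have hρ9 : 3 * ρ * 9 ≤ c / 2 := by rw [← hρk]; gcongr; linarith
  have hρu : 3 * ρ * 2 < 1 / (2 * k) := by
    rw [lt_div_iff₀ (by positivity)]
    nlinarith
  obtain ⟨C, hC1, hC⟩ := exists_card_divisors_le_rpow hρ0
  have hlog := (Real.tendsto_log_atTop.comp
    tendsto_natCast_atTop_atTop).eventually_ge_atTop ((2 + 2 * T) * 16 / ε)
  filter_upwards [Filter.eventually_ge_atTop 1, hlog,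
    eventually_const_mul_rpow_lt (2 ^ (2 * k + 13)) (by positivity : 0 < ε / 4),
    eventually_const_mul_rpow_lt (4 * C) (by linarith : 3 * ρ < ε / 4 * 2),
    eventually_const_mul_rpow_lt (4 * C ^ 2) (by linarith : 3 * ρ * 2 < 1 / 2),
    eventually_const_mul_rpow_lt (2 * C ^ 2) hρu,
    eventually_const_mul_rpow_lt (192 * C ^ 2 / ε) (by linarith : 3 * ρ * 2 + 1 / 3 < 1 / 2),
    eventually_const_mul_rpow_lt (8 * 2 ^ (2 * k + 3) * C ^ (6 * k + 3) / ε)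
      (by linarith : 3 * ρ * (6 * k + 3) < c)]
    with m hm1 hl e1 e2 e3 e4 e5 e6 lam
  have hm : (1 : ℝ) ≤ m := by exact_mod_cast hm1
  have hm0 : (0 : ℝ) < m := by linarith
  have : NeZero m := ⟨by omega⟩
  have hpow : ∀ (a : ℝ) (j : ℕ), ((m : ℝ) ^ a) ^ j = (m : ℝ) ^ (a * j) := fun a j => by
    rw [Real.rpow_mul hm0.le, Real.rpow_natCast]
  have hone : ∀ {a : ℝ}, 0 ≤ a → 1 ≤ (m : ℝ) ^ a := fun ha => Real.one_le_rpow hm ha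
  obtain ⟨x, hx, hprod⟩ := exists_six_factors_of_bounds (m := m) (k := k) (T := T) (ε := ε)
    (W := C * (m : ℝ) ^ (3 * ρ)) (R := (m : ℝ) ^ c) (g := (m : ℝ) ^ (ε / 4))
    (h := (m : ℝ) ^ (1 / 2 : ℝ)) (n := (m : ℝ) ^ (1 / 3 : ℝ)) (u := (m : ℝ) ^ (1 / (2 * k) : ℝ))
    hk1 hε hε1 hT1 hT (by positivity)
    (by rw [hpow]; push_cast; rw [hck])
    (by rw [hpow]; norm_num) (hone (by norm_num))
    (by rw [hpow]; norm_num) (hone (by norm_num))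
    (by rw [hpow]; congr 1; field_simp) (hone (by positivity))
    (Real.log_rpow hm0 _) (Real.log_rpow hm0 _) (Real.log_rpow hm0 _)
    (by
      apply Real.rpow_le_rpow_of_exponent_le hm
      rw [div_le_iff₀ (by positivity)]
      rw [div_le_iff₀ hε] at hk
      linarith)
    (by
      rw [Real.rpow_zero, mul_one] at e1
      exact e1.le)
    (by
      rw [hpow]
      apply Real.rpow_le_rpow_of_exponent_le hm
      push_cast
      linarith)
    (one_le_mul_of_one_le_of_one_le hC1 (hone (by positivity)))
    (by
      intro y hy hym
      refine (hC y (by omega)).trans ?_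
      gcongr
      calc (y : ℝ) ^ ρ ≤ ((m : ℝ) ^ 3) ^ ρ := by
            gcongr
            exact_mod_cast hym
        _ = (m : ℝ) ^ (3 * ρ) := by
            rw [Real.rpow_mul hm0.le]
            norm_num)
    (by
      rw [hpow]
      push_cast
      linarith)
    (by
      rw [mul_pow, hpow]
      push_cast
      linarith)
    (by
      rw [mul_pow, hpow]
      push_cast
      linarith)
    (by
      rw [mul_pow, hpow]
      push_cast
      rw [Real.rpow_add hm0, div_mul_eq_mul_div, div_lt_iff₀ hε] at e5
      linarith)
    (by
      rw [div_le_iff₀ hε] at hl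
      simp only [Function.comp] at hl
      linarith)
    (by
      rw [mul_pow, hpow]
      push_cast
      rw [div_mul_eq_mul_div, div_lt_iff₀ hε] at e6
      linarith) lam
  refine ⟨x, fun i => ⟨(hx i).1, (hx i).2.trans_eq ?_⟩, hprod⟩
  rw [hpow, ← Real.rpow_add hm0]
  congr 1
  push_cast
  ring

end

/-- For every ε > 0, every sufficiently large m and every unit λ of ℤ/mℤ, λ is a product of
six positive integers each at most m^(1/3+ε). -/
theorem stmt4 :
    ∀ ε : ℝ, 0 < ε → ∃ M : ℕ, ∀ m : ℕ, M ≤ m → ∀ lam : (ZMod m)ˣ,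
      ∃ x : Fin 6 → ℕ, (∀ i, 1 ≤ x i ∧ (x i : ℝ) ≤ (m : ℝ) ^ ((1 : ℝ)/3 + ε)) ∧
        (lam : ZMod m) = ((x 0 * x 1 * x 2 * x 3 * x 4 * x 5 : ℕ) : ZMod m) := by
  intro ε hε
  obtain ⟨M, hM⟩ := Filter.eventually_atTop.mp
    (eventually_exists_six_factors (lt_min hε (by norm_num : (0 : ℝ) < 1 / 10)) (min_le_right _ _))
  refine ⟨max M 1, fun m hm lam => ?_⟩
  obtain ⟨x, hx, hprod⟩ := hM m (le_of_max_le_left hm) lam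
  refine ⟨x, fun i => ⟨(hx i).1, (hx i).2.trans ?_⟩, hprod⟩
  apply Real.rpow_le_rpow_of_exponent_le
  · exact_mod_cast le_of_max_le_right hm
  · gcongr
    exact min_le_left _ _
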